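/- arXiv:2512.13366 — 9 statements merged into one kernel-verified Lean document; each statement's English description precedes it below -/
import Mathlib

section
/- Let Q be a real symmetric positive definite g×g matrix, let a be an extreme point of the Voronoi polytope V_Q, and let c₀ be a point of the Delaunay set 𝒟(a). Then a − c₀ is again an extreme point of V_Q. -/
open Matrix

/-- The quadratic form `xᵀ Q x` associated to a `g × g` real matrix `Q`. -/
noncomputable def quadForm {g : ℕ} (Q : Matrix (Fin g) (Fin g) ℝ) (x : Fin g → ℝ) : ℝ :=
  x ⬝ᵥ Q.mulVec x

/-- The real vector obtained from an integer vector by coordinatewise coercion. -/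
def intVec {g : ℕ} (c : Fin g → ℤ) : Fin g → ℝ := fun i => (c i : ℝ)

/-- The Voronoi polytope `V_Q = {a : aᵀQa ≤ (a−c)ᵀQ(a−c) for all c ∈ ℤ^g}`. -/
def voronoiPolytope {g : ℕ} (Q : Matrix (Fin g) (Fin g) ℝ) : Set (Fin g → ℝ) :=
  {a | ∀ c : Fin g → ℤ, quadForm Q a ≤ quadForm Q (a - intVec c)}

/-- The Delaunay set `𝒟(a) = {c ∈ ℤ^g : aᵀQa = (a−c)ᵀQ(a−c)}`. -/
def delaunaySet {g : ℕ} (Q : Matrix (Fin g) (Fin g) ℝ) (a : Fin g → ℝ) : Set (Fin g → ℤ) :=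
  {c | quadForm Q a = quadForm Q (a - intVec c)}

theorem quadForm_diff {g : ℕ} (Q : Matrix (Fin g) (Fin g) ℝ) (u c : Fin g → ℝ) :
    quadForm Q u - quadForm Q (u - c) = u ⬝ᵥ Q.mulVec c + c ⬝ᵥ Q.mulVec u - c ⬝ᵥ Q.mulVec c := by
  simp only [quadForm, Matrix.mulVec_sub, sub_dotProduct, dotProduct_sub]
  ring

theorem quadForm_diff_comb {g : ℕ} (Q : Matrix (Fin g) (Fin g) ℝ) (u v c : Fin g → ℝ) (t s : ℝ)
    (h : t + s = 1) :
    quadForm Q (t • u + s • v) - quadForm Q (t • u + s • v - c) =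
      t * (quadForm Q u - quadForm Q (u - c)) + s * (quadForm Q v - quadForm Q (v - c)) := by
  obtain rfl : s = 1 - t := by linarith
  simp only [quadForm_diff, Matrix.mulVec_add, Matrix.mulVec_smul, add_dotProduct, dotProduct_add,
    smul_dotProduct, dotProduct_smul, smul_eq_mul]
  ring

/-- If `a` is an extreme point (vertex) of the Voronoi polytope `V_Q` and `c₀ ∈ 𝒟(a)`,
then `a − c₀` is again an extreme point of `V_Q`. -/
theorem stmt0 {g : ℕ} (Q : Matrix (Fin g) (Fin g) ℝ) (hQs : Q.IsSymm) (hQpd : Q.PosDef)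
    (a : Fin g → ℝ) (ha : a ∈ Set.extremePoints ℝ (voronoiPolytope Q))
    (c₀ : Fin g → ℤ) (hc₀ : c₀ ∈ delaunaySet Q a) :
    a - intVec c₀ ∈ Set.extremePoints ℝ (voronoiPolytope Q) := by
  have hadd : ∀ c d : Fin g → ℤ, intVec (c + d) = intVec c + intVec d := by
    intro c d; ext i; simp [intVec]
  have hsub : ∀ c d : Fin g → ℤ, intVec (c - d) = intVec c - intVec d := by
    intro c d; ext i; simp [intVec]
  have hneg : ∀ c : Fin g → ℤ, intVec (-c) = - intVec c := by
    intro c; ext i; simp [intVec]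
  have hc : quadForm Q a = quadForm Q (a - intVec c₀) := hc₀
  refine ⟨fun c => ?_, ?_⟩
  · have := ha.1 (c₀ + c)
    rw [hadd, ← sub_sub] at this
    linarith
  · rintro x hx y hy ⟨t, s, ht, hs, hts, hxy⟩
    have hcomb : t • (x + intVec c₀) + s • (y + intVec c₀) = a := by
      have h1 : t • intVec c₀ + s • intVec c₀ = intVec c₀ := by
        rw [← add_smul, hts, one_smul]
      calc _ = (t • x + s • y) + (t • intVec c₀ + s • intVec c₀) := by
            simp only [smul_add]; abel
        _ = a := by rw [hxy, h1]; abel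
    have key := quadForm_diff_comb Q (x + intVec c₀) (y + intVec c₀) (intVec c₀) t s hts
    rw [hcomb, add_sub_cancel_right, add_sub_cancel_right, ← hc, sub_self] at key
    have fx : 0 ≤ quadForm Q (x + intVec c₀) - quadForm Q x := by
      have := hx (-c₀)
      rw [hneg, sub_neg_eq_add] at this
      linarith
    have fy : 0 ≤ quadForm Q (y + intVec c₀) - quadForm Q y := by
      have := hy (-c₀)
      rw [hneg, sub_neg_eq_add] at this
      linarith
    have px := mul_nonneg ht.le fx
    have py := mul_nonneg hs.le fy
    have ex : quadForm Q (x + intVec c₀) - quadForm Q x = 0 :=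
      (mul_eq_zero.1 (by linarith : t * _ = 0)).resolve_left ht.ne'
    have ey : quadForm Q (y + intVec c₀) - quadForm Q y = 0 :=
      (mul_eq_zero.1 (by linarith : s * _ = 0)).resolve_left hs.ne'
    have mem : ∀ z ∈ voronoiPolytope Q, quadForm Q (z + intVec c₀) - quadForm Q z = 0 →
        z + intVec c₀ ∈ voronoiPolytope Q := by
      intro z hz e c
      have := hz (c - c₀)
      rw [hsub, ← sub_add, sub_add_eq_add_sub] at this
      linarith
    have := ha.2 (mem x hx ex) (mem y hy ey) ⟨t, s, ht, hs, hts, hcomb⟩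
    exact eq_sub_of_add_eq this
end

section
/- Let Q be a real symmetric positive definite g×g matrix and let a, a' be extreme points of the Voronoi polytope V_Q. Then a ~ a' (i.e. a' = a − c₀ for some c₀ ∈ 𝒟(a)) if and only if there exists c₀ ∈ 𝒟(a) with a' = a − c₀ and 𝒟(a') = 𝒟(a) − c₀. In particular, if 𝒟(a') = 𝒟(a) − c₀ for some c₀ ∈ 𝒟(a), then a' = a − c₀. -/
open Matrix

lemma qf_sub {g : ℕ} (Q : Matrix (Fin g) (Fin g) ℝ) (hQs : Q.IsSymm) (x y : Fin g → ℝ) :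
    quadForm Q (x - y) = quadForm Q x - 2 * (x ⬝ᵥ Q.mulVec y) + quadForm Q y := by
  have h : y ⬝ᵥ Q.mulVec x = x ⬝ᵥ Q.mulVec y := by
    rw [dotProduct_mulVec, ← mulVec_transpose, hQs.eq, dotProduct_comm]
  unfold quadForm
  simp only [mulVec_sub, sub_dotProduct, dotProduct_sub, h]
  ring

lemma qf_nonneg {g : ℕ} (Q : Matrix (Fin g) (Fin g) ℝ) (hQpd : Q.PosDef) (x : Fin g → ℝ) :
    0 ≤ quadForm Q x := by
  have := hQpd.posSemidef.dotProduct_mulVec_nonneg x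
  simpa [quadForm] using this

lemma qf_bound {g : ℕ} (Q : Matrix (Fin g) (Fin g) ℝ) (hQs : Q.IsSymm) (hQpd : Q.PosDef)
    (i : Fin g) : ∃ w : ℝ, ∀ x, 2 * |x i| ≤ quadForm Q x + w := by
  refine ⟨quadForm Q (Q⁻¹.mulVec (Pi.single i 1)), fun x => ?_⟩
  have hu : IsUnit Q.det := (Matrix.isUnit_iff_isUnit_det Q).1 hQpd.isUnit
  have h : ∀ x : Fin g → ℝ, 2 * x i ≤ quadForm Q x + quadForm Q (Q⁻¹.mulVec (Pi.single i 1)) := by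
    intro x
    have h1 := qf_nonneg Q hQpd (x - Q⁻¹.mulVec (Pi.single i 1))
    rw [qf_sub Q hQs, mulVec_mulVec, Matrix.mul_nonsing_inv Q hu, one_mulVec,
      dotProduct_single_one] at h1
    linarith
  have h2 := h x
  have h3 := h (-x)
  have h4 : quadForm Q (-x) = quadForm Q x := by simp [quadForm, mulVec_neg]
  rw [h4] at h3
  simp only [Pi.neg_apply] at h3
  rcases abs_cases (x i) with h | h <;> linarith

lemma fin_ball {g : ℕ} (Q : Matrix (Fin g) (Fin g) ℝ) (hQs : Q.IsSymm) (hQpd : Q.PosDef)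
    (p : Fin g → ℝ) (R : ℝ) : {c : Fin g → ℤ | quadForm Q (p - intVec c) ≤ R}.Finite := by
  choose w hw using qf_bound Q hQs hQpd
  refine (Set.finite_Icc (fun i => ⌊p i - (R + w i)/2⌋) (fun i => ⌈p i + (R + w i)/2⌉)).subset ?_
  intro c hc
  simp only [Set.mem_ofPred_eq] at hc
  have h : ∀ i, |p i - c i| ≤ (R + w i)/2 := by
    intro i
    have := hw i (p - intVec c)
    simp only [Pi.sub_apply, intVec] at this hc
    linarith
  constructor <;> intro i <;> have := abs_le.1 (h i)
  · have h1 := Int.floor_le (p i - (R + w i)/2)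
    show ⌊p i - (R + w i)/2⌋ ≤ c i
    exact_mod_cast (by linarith : ((⌊p i - (R + w i)/2⌋ : ℤ) : ℝ) ≤ c i)
  · have h1 := Int.le_ceil (p i + (R + w i)/2)
    show c i ≤ ⌈p i + (R + w i)/2⌉
    exact_mod_cast (by linarith : (c i : ℝ) ≤ ((⌈p i + (R + w i)/2⌉ : ℤ) : ℝ))

lemma mem_vor {g : ℕ} (Q : Matrix (Fin g) (Fin g) ℝ) (hQs : Q.IsSymm) (a : Fin g → ℝ) :
    a ∈ voronoiPolytope Q ↔
      ∀ c : Fin g → ℤ, 2 * (a ⬝ᵥ Q.mulVec (intVec c)) ≤ quadForm Q (intVec c) := by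
  simp only [voronoiPolytope, Set.mem_ofPred_eq, qf_sub Q hQs]
  constructor <;> intro h c <;> linarith [h c]

lemma mem_del {g : ℕ} (Q : Matrix (Fin g) (Fin g) ℝ) (hQs : Q.IsSymm) (a : Fin g → ℝ)
    (c : Fin g → ℤ) : c ∈ delaunaySet Q a ↔
      2 * (a ⬝ᵥ Q.mulVec (intVec c)) = quadForm Q (intVec c) := by
  simp only [delaunaySet, Set.mem_ofPred_eq, qf_sub Q hQs]
  constructor <;> intro h <;> linarith

lemma intVec_add {g : ℕ} (c d : Fin g → ℤ) : intVec (c + d) = intVec c + intVec d := by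
  ext i; simp [intVec]

lemma intVec_neg {g : ℕ} (c : Fin g → ℤ) : intVec (-c) = - intVec c := by
  ext i; simp [intVec]

lemma del_shift {g : ℕ} (Q : Matrix (Fin g) (Fin g) ℝ) (a : Fin g → ℝ) (c₀ : Fin g → ℤ)
    (h : c₀ ∈ delaunaySet Q a) :
    delaunaySet Q (a - intVec c₀) = (fun c => c - c₀) '' delaunaySet Q a := by
  have h' : quadForm Q a = quadForm Q (a - intVec c₀) := h
  ext c
  constructor
  · intro hc
    have hc' : quadForm Q (a - intVec c₀) = quadForm Q (a - intVec c₀ - intVec c) := hc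
    refine ⟨c + c₀, ?_, by simp⟩
    show quadForm Q a = quadForm Q (a - intVec (c + c₀))
    rw [h', hc', intVec_add, sub_sub, add_comm (intVec c)]
  · rintro ⟨d, hd, rfl⟩
    have hd' : quadForm Q a = quadForm Q (a - intVec d) := hd
    show quadForm Q (a - intVec c₀) = quadForm Q (a - intVec c₀ - intVec (d - c₀))
    rw [← h', hd', sub_sub, ← intVec_add, add_sub_cancel]

lemma vor_shift {g : ℕ} (Q : Matrix (Fin g) (Fin g) ℝ) (a : Fin g → ℝ) (c₀ : Fin g → ℤ)
    (h : c₀ ∈ delaunaySet Q a) (ha : a ∈ voronoiPolytope Q) :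
    a - intVec c₀ ∈ voronoiPolytope Q := by
  have h' : quadForm Q a = quadForm Q (a - intVec c₀) := h
  intro c
  rw [← h', sub_sub, ← intVec_add]
  exact ha _

lemma eq_of_del {g : ℕ} (Q : Matrix (Fin g) (Fin g) ℝ) (hQs : Q.IsSymm) (hQpd : Q.PosDef)
    (a b : Fin g → ℝ) (ha : a ∈ Set.extremePoints ℝ (voronoiPolytope Q))
    (hb : b ∈ voronoiPolytope Q) (hab : delaunaySet Q a = delaunaySet Q b) : a = b := by
  have haV := (mem_vor Q hQs a).1 ha.1
  have hbV := (mem_vor Q hQs b).1 hb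
  have hF := fin_ball Q hQs hQpd ((2:ℝ) • a) (quadForm Q ((2:ℝ) • a))
  set F := {c : Fin g → ℤ | quadForm Q ((2:ℝ) • a - intVec c) ≤ quadForm Q ((2:ℝ) • a)} with hFdef
  have hev : ∀ᶠ ε : ℝ in nhdsWithin 0 (Set.Ioi 0), ∀ c ∈ F,
      2 * ((a - ε • (b - a)) ⬝ᵥ Q.mulVec (intVec c)) ≤ quadForm Q (intVec c) := by
    rw [Filter.eventually_all_finite hF]
    intro c _
    by_cases hc : c ∈ delaunaySet Q a
    · have h1 := (mem_del Q hQs a c).1 hc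
      have h2 := (mem_del Q hQs b c).1 (hab ▸ hc)
      refine Filter.Eventually.of_forall fun ε => ?_
      simp only [sub_dotProduct, smul_dotProduct, smul_eq_mul]
      have : b ⬝ᵥ Q.mulVec (intVec c) = a ⬝ᵥ Q.mulVec (intVec c) := by linarith
      rw [this]; linarith
    · have h1 : 2 * (a ⬝ᵥ Q.mulVec (intVec c)) < quadForm Q (intVec c) :=
        lt_of_le_of_ne (haV c) (fun h => hc ((mem_del Q hQs a c).2 h))
      have hcont : Continuous fun ε : ℝ =>
          2 * ((a - ε • (b - a)) ⬝ᵥ Q.mulVec (intVec c)) := by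
        simp only [sub_dotProduct, smul_dotProduct, smul_eq_mul]
        fun_prop
      have := (hcont.tendsto 0).eventually_lt_const (u := quadForm Q (intVec c))
        (by simpa using h1)
      exact (this.filter_mono nhdsWithin_le_nhds).mono fun _ h => h.le
  have hsm : ∀ᶠ ε : ℝ in nhdsWithin 0 (Set.Ioi 0), ε ≤ 1/4 :=
    (eventually_le_nhds (by norm_num : (0:ℝ) < 1/4)).filter_mono nhdsWithin_le_nhds
  obtain ⟨ε, ⟨h1, h2⟩, h3⟩ := ((hev.and hsm).and self_mem_nhdsWithin).exists
  have hε : 0 < ε := h3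
  have hm : a - ε • (b - a) ∈ voronoiPolytope Q := by
    rw [mem_vor Q hQs]
    intro c
    by_cases hc : c ∈ F
    · exact h1 c hc
    · have h4 : quadForm Q ((2:ℝ) • a) < quadForm Q ((2:ℝ) • a - intVec c) := not_le.1 hc
      rw [qf_sub Q hQs] at h4
      have h5 := hbV (-c)
      have h6 : quadForm Q (-intVec c) = quadForm Q (intVec c) := by simp [quadForm, mulVec_neg]
      rw [intVec_neg, h6, mulVec_neg, dotProduct_neg] at h5
      simp only [sub_dotProduct, smul_dotProduct, smul_eq_mul] at h4 ⊢
      have h7 := qf_nonneg Q hQpd (intVec c)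
      nlinarith
  have hseg : a ∈ openSegment ℝ b (a - ε • (b - a)) := by
    refine ⟨ε / (1 + ε), 1 / (1 + ε), by positivity, by positivity, by field_simp; ring, ?_⟩
    ext i
    simp only [Pi.add_apply, Pi.smul_apply, Pi.sub_apply, smul_eq_mul]
    field_simp
    ring
  exact (ha.2 hb hm hseg).symm

/-- For extreme points `a, a'` of the Voronoi polytope: `a ~ a'` (i.e. `a' = a − c₀` for some
`c₀ ∈ 𝒟(a)`) iff there is `c₀ ∈ 𝒟(a)` with `a' = a − c₀` and `𝒟(a') = 𝒟(a) − c₀`.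
In particular, if `𝒟(a') = 𝒟(a) − c₀` for some `c₀ ∈ 𝒟(a)`, then `a' = a − c₀`. -/
theorem stmt2 {g : ℕ} (Q : Matrix (Fin g) (Fin g) ℝ) (hQs : Q.IsSymm) (hQpd : Q.PosDef)
    (a a' : Fin g → ℝ)
    (ha : a ∈ Set.extremePoints ℝ (voronoiPolytope Q))
    (ha' : a' ∈ Set.extremePoints ℝ (voronoiPolytope Q)) :
    ((∃ c₀ ∈ delaunaySet Q a, a' = a - intVec c₀) ↔
      (∃ c₀ ∈ delaunaySet Q a, a' = a - intVec c₀ ∧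
        delaunaySet Q a' = (fun c => c - c₀) '' delaunaySet Q a)) ∧
    (∀ c₀ ∈ delaunaySet Q a,
      delaunaySet Q a' = (fun c => c - c₀) '' delaunaySet Q a → a' = a - intVec c₀) := by
  constructor
  · constructor
    · rintro ⟨c₀, hc, rfl⟩
      exact ⟨c₀, hc, rfl, del_shift Q a c₀ hc⟩
    · rintro ⟨c₀, hc, h, _⟩
      exact ⟨c₀, hc, h⟩
  · intro c₀ hc h
    exact eq_of_del Q hQs hQpd _ _ ha' (vor_shift Q a c₀ hc ha.1) (h.trans (del_shift Q a c₀ hc).symm)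
end

section
/- For the tropical Riemann matrix Q of the genus-g banana graph, the set of extreme points of the Voronoi polytope V_Q is exactly the union ⋃_{k=1}^{g} [k] of the classes [k], and this set has exactly 2·(2^g − 1) elements. -/
open Matrix

/-- The tropical Riemann matrix of the genus-`g` banana graph: diagonal entries `2`,
off-diagonal entries `1`. -/
noncomputable def bananaQ (g : ℕ) : Matrix (Fin g) (Fin g) ℝ :=
  Matrix.of fun i j => if i = j then 2 else 1

/-- The class `[k]` of Voronoi vertices: vectors with all coordinates in
`{−k/(g+1), (g+1−k)/(g+1)}` and either `k` or `k−1` coordinates equal to `(g+1−k)/(g+1)`. -/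
def bananaClass (g k : ℕ) : Set (Fin g → ℝ) :=
  {a | (∀ i, a i = -(k : ℝ) / ((g : ℝ) + 1) ∨ a i = ((g : ℝ) + 1 - (k : ℝ)) / ((g : ℝ) + 1)) ∧
       ({i | a i = ((g : ℝ) + 1 - (k : ℝ)) / ((g : ℝ) + 1)}.ncard = k ∨
        {i | a i = ((g : ℝ) + 1 - (k : ℝ)) / ((g : ℝ) + 1)}.ncard = k - 1)}

/-- The linear map `Bᵀ : ℝ^g → ℝ^{g+1}`, where `B` is the `g × (g+1)` matrix whose `i`-th row
is `e₁ − e_{i+1}`. -/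
noncomputable def bananaBT (g : ℕ) (a : Fin g → ℝ) : Fin (g + 1) → ℝ :=
  fun j => ∑ i : Fin g,
    ((if (j : ℕ) = 0 then (1 : ℝ) else 0) - (if (j : ℕ) = (i : ℕ) + 1 then 1 else 0)) * a i

def xt {g : ℕ} (a : Fin g → ℝ) : Fin (g + 1) → ℝ := Fin.cons (-∑ i, a i) a

lemma xt_sum {g : ℕ} (a : Fin g → ℝ) : ∑ j, xt a j = 0 := by
  simp [xt, Fin.sum_univ_succ]

lemma xt_succ {g : ℕ} (a : Fin g → ℝ) (i : Fin g) : xt a i.succ = a i := by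
  simp [xt]

lemma xt_inj {g : ℕ} {a b : Fin g → ℝ} (h : ∀ j, xt a j = xt b j) : a = b := by
  funext i
  rw [← xt_succ a, ← xt_succ b, h]

lemma xt_comb {g : ℕ} (s t : ℝ) (a b : Fin g → ℝ) (j : Fin (g + 1)) :
    xt (s • a + t • b) j = s * xt a j + t * xt b j := by
  refine Fin.cases ?_ (fun i => ?_) j
  · simp [xt, Finset.sum_add_distrib, Finset.mul_sum]; ring
  · simp [xt]

lemma xt_sub {g : ℕ} (a b : Fin g → ℝ) (j : Fin (g + 1)) :
    xt (a - b) j = xt a j - xt b j := by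
  refine Fin.cases ?_ (fun i => ?_) j
  · simp [xt, Finset.sum_sub_distrib]; ring
  · simp [xt]

lemma xt_of {g : ℕ} (y : Fin (g + 1) → ℝ) (h : ∑ j, y j = 0) (j : Fin (g + 1)) :
    xt (fun i => y i.succ) j = y j := by
  rw [Fin.sum_univ_succ] at h
  refine Fin.cases ?_ (fun i => ?_) j
  · simp [xt]; linarith
  · simp [xt]

lemma quadForm_eq {g : ℕ} (a : Fin g → ℝ) :
    quadForm (bananaQ g) a = ∑ j, xt a j ^ 2 := by
  have h : ∀ i, (bananaQ g).mulVec a i = a i + ∑ j, a j := by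
    intro i
    have : ∀ j, (if i = j then (2:ℝ) else 1) * a j = (if i = j then a j else 0) + a j := by
      intro j; split_ifs <;> ring
    simp [bananaQ, Matrix.mulVec, dotProduct, this, Finset.sum_add_distrib]
  simp only [quadForm, dotProduct, h, Fin.sum_univ_succ, xt, Fin.cons_zero, Fin.cons_succ,
    mul_add, Finset.sum_add_distrib, ← Finset.sum_mul]
  rw [add_comm]
  congr 1
  · ring
  · exact Finset.sum_congr rfl fun i _ => by ring

lemma mem_V {g : ℕ} (a : Fin g → ℝ) :
    a ∈ voronoiPolytope (bananaQ g) ↔ ∀ i j, xt a i - xt a j ≤ 1 := by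
  have key : ∀ c : Fin g → ℤ, quadForm (bananaQ g) a ≤ quadForm (bananaQ g) (a - intVec c) ↔
      0 ≤ ∑ j, (xt (intVec c) j ^ 2 - 2 * xt a j * xt (intVec c) j) := by
    intro c
    rw [quadForm_eq, quadForm_eq, ← sub_nonneg, ← Finset.sum_sub_distrib]
    have : ∀ j, xt (a - intVec c) j ^ 2 - xt a j ^ 2 =
      xt (intVec c) j ^ 2 - 2 * xt a j * xt (intVec c) j := by
      intro j; rw [xt_sub]; ring
    simp only [this]
  constructor
  · intro h i j
    by_cases hij : i = j
    · subst hij; simp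
    let e : Fin (g + 1) → ℤ := fun l => (if l = i then 1 else 0) - (if l = j then 1 else 0)
    have h1 := (key (fun l => e l.succ)).1 (h _)
    have h2 : ∀ l, xt (intVec (fun l => e l.succ)) l = (e l : ℝ) := by
      intro l
      exact xt_of (fun l => (e l : ℝ)) (by simp [e]) l
    simp only [h2] at h1
    have h3 : ∀ l, ((e l : ℝ) ^ 2 - 2 * xt a l * (e l : ℝ)) =
        (if l = i then 1 - 2 * xt a l else 0) + (if l = j then 1 + 2 * xt a l else 0) := by
      intro l
      by_cases hi : l = i
      · subst hi; simp [e, hij]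
      · by_cases hj : l = j
        · subst hj; simp [e, hi]
        · simp [e, hi, hj]
    simp only [h3, Finset.sum_add_distrib, Finset.sum_ite_eq', Finset.mem_univ, if_true] at h1
    linarith
  · intro h c
    rw [key]
    obtain ⟨m, hm⟩ := Finite.exists_min (xt a)
    have hint : ∀ j, ∃ z : ℤ, xt (intVec c) j = z := by
      intro j
      refine Fin.cases ⟨-∑ i, c i, ?_⟩ (fun i => ⟨c i, ?_⟩) j
      · simp [xt, intVec]
      · simp [xt, intVec]
    have hs : ∑ j, (xt (intVec c) j ^ 2 - 2 * xt a j * xt (intVec c) j) =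
      ∑ j, (xt (intVec c) j ^ 2 - 2 * (xt a j - (xt a m + 1 / 2)) * xt (intVec c) j) := by
      have : ∀ j, xt (intVec c) j ^ 2 - 2 * (xt a j - (xt a m + 1 / 2)) * xt (intVec c) j =
        (xt (intVec c) j ^ 2 - 2 * xt a j * xt (intVec c) j) + 
          2 * (xt a m + 1 / 2) * xt (intVec c) j := by intro j; ring
      simp only [this]
      rw [Finset.sum_add_distrib, ← Finset.mul_sum, xt_sum]; simp
    rw [hs]
    refine Finset.sum_nonneg fun j _ => ?_
    obtain ⟨z, hz⟩ := hint j
    rw [hz]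
    have h1 := hm j
    have h2 := h j m
    rcases le_or_gt z 0 with h0 | h0
    · rcases eq_or_lt_of_le h0 with h0 | h0
      · simp [h0]
      · have : (z : ℝ) ≤ -1 := by exact_mod_cast (by omega : z ≤ -1)
        nlinarith
    · have : (1 : ℝ) ≤ z := by exact_mod_cast h0
      nlinarith

noncomputable def bvec {g : ℕ} (S : Finset (Fin (g + 1))) : Fin g → ℝ :=
  fun i => (if i.succ ∈ S then 1 else 0) - (S.card : ℝ) / ((g : ℝ) + 1)

lemma xt_vec {g : ℕ} (S : Finset (Fin (g + 1))) (j : Fin (g + 1)) :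
    xt (bvec S) j = (if j ∈ S then 1 else 0) - (S.card : ℝ) / ((g : ℝ) + 1) := by
  refine xt_of (fun j => (if j ∈ S then 1 else 0) - (S.card : ℝ) / ((g : ℝ) + 1)) ?_ j
  have : (g : ℝ) + 1 ≠ 0 := by positivity
  simp [Finset.sum_sub_distrib]
  field_simp
  simp

/-- index set -/
def good (g : ℕ) : Finset (Finset (Fin (g + 1))) := {∅, Finset.univ}ᶜ

lemma mem_good {g : ℕ} (S : Finset (Fin (g + 1))) :
    S ∈ good g ↔ S.Nonempty ∧ ∃ j, j ∉ S := by
  simp only [good, Finset.mem_compl, Finset.mem_insert, Finset.mem_singleton, not_or,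
    Finset.nonempty_iff_ne_empty, Finset.eq_univ_iff_forall, not_forall, ne_eq]

lemma card_good (g : ℕ) : (good g).card = 2 * (2 ^ g - 1) := by
  rw [good, Finset.card_compl, Finset.card_pair]
  · simp [pow_succ]; omega
  · exact (Finset.univ_nonempty (α := Fin (g+1))).ne_empty.symm

lemma vec_injOn (g : ℕ) : Set.InjOn (bvec (g := g)) (good g) := by
  intro S hS T hT h
  obtain ⟨⟨s, hs⟩, s', hs'⟩ := (mem_good S).1 hS
  obtain ⟨⟨t, ht⟩, t', ht'⟩ := (mem_good T).1 hT
  have e : ∀ j, (if j ∈ S then (1:ℝ) else 0) - (S.card : ℝ) / ((g : ℝ) + 1) =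
     (if j ∈ T then 1 else 0) - (T.card : ℝ) / ((g : ℝ) + 1) := by
    intro j; rw [← xt_vec, ← xt_vec, h]
  have h1 := e s
  have h2 := e s'
  have h3 := e t
  have h4 := e t'
  simp only [hs, hs', ht, ht', if_true, if_false] at h1 h2 h3 h4
  have hc : (S.card : ℝ) / ((g : ℝ) + 1) = (T.card : ℝ) / ((g : ℝ) + 1) := by
    split_ifs at h1 h2 h3 h4 <;> linarith
  ext j
  have := e j
  rw [hc] at this
  by_cases a : j ∈ S <;> by_cases b : j ∈ T <;> simp only [a, b, if_true, if_false] at this ⊢ <;> linarith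

lemma extreme_eq (g : ℕ) (hg : 1 ≤ g) :
    Set.extremePoints ℝ (voronoiPolytope (bananaQ g)) = bvec '' (good g : Set _) := by
  have hn : (0 : ℝ) < (g : ℝ) + 1 := by positivity
  ext a
  rw [mem_extremePoints_iff_left]
  constructor
  · rintro ⟨ha, hext⟩
    have hV := (mem_V a).1 ha
    have hall : ∀ l, ∃ i, xt a l - xt a i = 1 ∨ xt a i - xt a l = 1 := by
      intro l
      by_contra! hl
      have hl' : ∀ i, 0 < 1 - |xt a l - xt a i| := by
        intro i
        have h1 := lt_of_le_of_ne (hV l i) (hl i).1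
        have h2 := lt_of_le_of_ne (hV i l) (hl i).2
        have := abs_lt.2 ⟨by linarith, h1⟩
        linarith
      obtain ⟨m, hm⟩ := Finite.exists_min (fun i => 1 - |xt a l - xt a i|)
      set ε := 1 - |xt a l - xt a m| with hε
      have hε0 : 0 < ε := hl' m
      let y : Fin (g + 1) → ℝ := fun j => (if j = l then 1 else 0) - 1 / ((g : ℝ) + 1)
      have hy : ∀ j, xt (fun i => y i.succ) j = y j := by
        refine xt_of y ?_
        simp [y, Finset.sum_sub_distrib]
        field_simp
        simp
      have hmem : ∀ s : ℝ, |s| ≤ ε → (1:ℝ) • a + s • (fun i : Fin g => y i.succ) ∈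
          voronoiPolytope (bananaQ g) := by
        intro s hs
        rw [mem_V]
        intro i j
        rw [xt_comb, xt_comb, hy, hy]
        have hs' := abs_le.1 hs
        have := hV i j
        have hi := hm i
        have hj := hm j
        have hi1 := le_abs_self (xt a l - xt a i)
        have hi2 := neg_abs_le (xt a l - xt a i)
        have hj1 := le_abs_self (xt a l - xt a j)
        have hj2 := neg_abs_le (xt a l - xt a j)
        simp only [y] at *
        by_cases h1 : i = l <;> by_cases h2 : j = l
        · rw [h1, h2]; simp
        · rw [if_pos h1, if_neg h2, h1]; linarith
        · rw [if_neg h1, if_pos h2, h2]; linarith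
        · rw [if_neg h1, if_neg h2]; linarith
      have := (hext _ (hmem ε (by rw [abs_of_pos hε0])) _
        (hmem (-ε) (by rw [abs_neg, abs_of_pos hε0])) ⟨1/2, 1/2, by norm_num, by norm_num,
          by norm_num, by ext i; simp; ring⟩)
      have h5 := congrArg (fun b => xt b l) this
      simp only [xt_comb, hy, y, if_true] at h5
      have h6 : 1 / ((g : ℝ) + 1) < 1 := by
        rw [div_lt_one hn]
        have : (1:ℝ) ≤ g := by exact_mod_cast hg
        linarith
      have : 0 < ε * (1 - 1 / ((g : ℝ) + 1)) := mul_pos hε0 (by linarith)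
      linarith
    obtain ⟨M, hM⟩ := Finite.exists_max (xt a)
    have hdi : ∀ l, xt a l = xt a M ∨ xt a l = xt a M - 1 := by
      intro l
      obtain ⟨i, h | h⟩ := hall l
      · left; linarith [hM l, hV M i]
      · right; linarith [hM i, hV M l]
    classical
    let S : Finset (Fin (g + 1)) := Finset.univ.filter fun l => xt a l = xt a M
    have hx : ∀ l, xt a l = (if l ∈ S then 1 else 0) + (xt a M - 1) := by
      intro l
      by_cases h : xt a l = xt a M
      · simp [S, h]
      · simp [S, h, (hdi l).resolve_left h]
    have hsum := xt_sum a
    rw [Finset.sum_congr rfl (fun j _ => hx j)] at hsum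
    have hMS : M ∈ S := by simp [S]
    simp only [Finset.sum_add_distrib] at hsum
    simp at hsum
    refine ⟨S, ?_, ?_⟩
    · rw [Finset.mem_coe, mem_good]
      refine ⟨⟨M, hMS⟩, ?_⟩
      obtain ⟨i, h | h⟩ := hall M
      · refine ⟨i, ?_⟩
        simp only [S, Finset.mem_filter, Finset.mem_univ, true_and]
        intro h'; linarith
      · linarith [hM i]
    · refine xt_inj fun j => ?_
      rw [xt_vec, hx]
      have : (S.card : ℝ) / ((g : ℝ) + 1) = -(xt a M - 1) := by
        rw [div_eq_iff hn.ne']; linarith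
      rw [this]; ring
  · rintro ⟨S, hS, rfl⟩
    obtain ⟨⟨s, hs⟩, t, ht⟩ := (mem_good S).1 hS
    constructor
    · rw [mem_V]
      intro i j
      rw [xt_vec, xt_vec]
      split_ifs <;> linarith
    · rintro y hy z hz ⟨p, q, hp, hq, hpq, h⟩
      rw [mem_V] at hy hz
      have hd : ∀ i ∈ S, ∀ j, j ∉ S → xt y i - xt y j = 1 := by
        intro i hi j hj
        have e1 := xt_vec S i
        have e2 := xt_vec S j
        rw [← h, xt_comb] at e1 e2
        rw [if_pos hi] at e1
        rw [if_neg hj] at e2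
        refine le_antisymm (hy i j) ?_
        by_contra! hlt
        have := mul_lt_mul_of_pos_left hlt hp
        have := mul_le_mul_of_nonneg_left (hz i j) hq.le
        linarith
      have hx : ∀ j, xt y j = (if j ∈ S then 1 else 0) + xt y t := by
        intro j
        by_cases hj : j ∈ S
        · rw [if_pos hj]; linarith [hd j hj t ht]
        · rw [if_neg hj]; linarith [hd s hs t ht, hd s hs j hj]
      have hsum := xt_sum y
      rw [Finset.sum_congr rfl (fun j _ => hx j)] at hsum
      simp only [Finset.sum_add_distrib] at hsum
      simp at hsum
      refine xt_inj fun j => ?_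
      rw [xt_vec, hx]
      have : (S.card : ℝ) / ((g : ℝ) + 1) = -(xt y t) := by
        rw [div_eq_iff hn.ne']; linarith
      rw [this]; ring

lemma card_split {g : ℕ} (S : Finset (Fin (g + 1))) :
    S.card = (if 0 ∈ S then 1 else 0) + {i : Fin g | i.succ ∈ S}.ncard := by
  classical
  have h1 : S.card = ∑ j, if j ∈ S then 1 else 0 := by simp
  rw [h1, Fin.sum_univ_succ, Set.ncard_eq_toFinset_card']
  simp

lemma classes_eq (g : ℕ) :
    (⋃ k ∈ Finset.Icc 1 g, bananaClass g k) = bvec '' (good g : Set _) := by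
  classical
  have hn : (0 : ℝ) < (g : ℝ) + 1 := by positivity
  have hup : ∀ k : ℕ, ((g : ℝ) + 1 - (k : ℝ)) / ((g : ℝ) + 1) = 1 - (k : ℝ) / ((g : ℝ) + 1) := by
    intro k; field_simp
  have hdn : ∀ k : ℕ, -(k : ℝ) / ((g : ℝ) + 1) = 0 - (k : ℝ) / ((g : ℝ) + 1) := by
    intro k; ring
  ext a
  simp only [Set.mem_iUnion, exists_prop, Finset.mem_Icc, bananaClass, Set.mem_ofPred_eq, hup, hdn]
  constructor
  · rintro ⟨k, ⟨hk1, hkg⟩, hco, hcard⟩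
    have hS : ∃ S : Finset (Fin (g + 1)), S.card = k ∧
        ∀ i : Fin g, i.succ ∈ S ↔ a i = 1 - (k : ℝ) / ((g : ℝ) + 1) := by
      let x : Fin (g + 1) → Prop := Fin.cons
        (¬ {i | a i = 1 - (k : ℝ) / ((g : ℝ) + 1)}.ncard = k)
        (fun i => a i = 1 - (k : ℝ) / ((g : ℝ) + 1))
      refine ⟨Finset.univ.filter x, ?_, ?_⟩
      · rw [card_split]
        simp only [Finset.mem_filter, Finset.mem_univ, true_and, x, Fin.cons_zero, Fin.cons_succ]
        split_ifs <;> omega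
      · intro i; simp [x]
    obtain ⟨S, hSk, hSi⟩ := hS
    refine ⟨S, ?_, ?_⟩
    · rw [Finset.mem_coe, mem_good]
      refine ⟨Finset.card_pos.1 (by omega), ?_⟩
      by_contra! h
      rw [← Finset.eq_univ_iff_forall] at h
      rw [h] at hSk
      simp at hSk
      omega
    · funext i
      simp only [bvec, hSi, hSk]
      split_ifs with h
      · exact h.symm
      · exact ((hco i).resolve_right h).symm
  · rintro ⟨S, hS, rfl⟩
    obtain ⟨hs, t, ht⟩ := (mem_good S).1 hS
    have hlt : S.card < g + 1 := by
      have := Finset.card_lt_univ_of_notMem ht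
      simpa using this
    have hiff : ∀ i : Fin g, bvec S i = 1 - (S.card : ℝ) / ((g : ℝ) + 1) ↔ i.succ ∈ S := by
      intro i
      by_cases h : i.succ ∈ S
      · simp [bvec, h]
      · simp only [bvec, h, if_false, iff_false]
        intro h'; linarith
    refine ⟨S.card, ⟨hs.card_pos, by omega⟩, ?_, ?_⟩
    · intro i
      by_cases h : i.succ ∈ S <;> simp [bvec, h]
    · simp only [hiff]
      have := card_split S
      split_ifs at this <;> omega

/-- The extreme points of the Voronoi polytope of the genus-`g` banana graph are exactly
`⋃_{k=1}^{g} [k]`, and there are exactly `2(2^g − 1)` of them. -/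
theorem stmt4 (g : ℕ) (hg : 1 ≤ g) :
    (Set.extremePoints ℝ (voronoiPolytope (bananaQ g)) =
      ⋃ k ∈ Finset.Icc 1 g, bananaClass g k) ∧
    (Set.extremePoints ℝ (voronoiPolytope (bananaQ g))).ncard = 2 * (2 ^ g - 1) := by
  refine ⟨by rw [extreme_eq g hg, classes_eq], ?_⟩
  rw [extreme_eq g hg, Set.InjOn.ncard_image (vec_injOn g), Set.ncard_coe_finset, card_good]
end

section
/- Let Q be the tropical Riemann matrix of the genus-g banana graph and let a, a' be extreme points of the Voronoi polytope V_Q. Then a ~ a' (i.e. a' = a − c₀ for some c₀ ∈ 𝒟(a)) if and only if there exists k ∈ {1,…,g} such that both a and a' lie in the class [k]. -/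
open Matrix

lemma qf (g : ℕ) (x : Fin g → ℝ) : quadForm (bananaQ g) x = ∑ i, x i ^ 2 + (∑ i, x i) ^ 2 := by
  have h : ∀ i, (bananaQ g).mulVec x i = x i + ∑ j, x j := by
    intro i
    have : ∀ j, bananaQ g i j * x j = (if i = j then x j else 0) + x j := by
      intro j
      by_cases h : i = j <;> simp [bananaQ, h]
      ring
    simp [Matrix.mulVec, dotProduct, this, Finset.sum_add_distrib]
  simp only [quadForm, dotProduct, h, mul_add, Finset.sum_add_distrib, ← Finset.sum_mul]
  simp only [pow_two]

lemma qf_sub_s5 (g : ℕ) (a : Fin g → ℝ) (c : Fin g → ℤ) :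
    quadForm (bananaQ g) (a - intVec c) - quadForm (bananaQ g) a =
      ∑ i, ((c i : ℝ) ^ 2 - 2 * a i * c i) + ((∑ i, (c i : ℝ)) ^ 2
        - 2 * (∑ i, a i) * ∑ i, (c i : ℝ)) := by
  have e : ∑ i, (a i - (c i : ℝ)) ^ 2 = ∑ i, a i ^ 2 + ∑ i, ((c i : ℝ) ^ 2 - 2 * a i * c i) := by
    rw [← Finset.sum_add_distrib]
    exact Finset.sum_congr rfl fun i _ => by ring
  simp only [qf, intVec, Pi.sub_apply, e, Finset.sum_sub_distrib (f := a)]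
  ring

/-- projection of the cube -/
noncomputable def projL (g : ℕ) : (Fin (g + 1) → ℝ) →ₗ[ℝ] (Fin g → ℝ) where
  toFun y := fun i => y i.succ - (∑ j, y j) / ((g : ℝ) + 1)
  map_add' x y := by
    ext i
    simp only [Pi.add_apply, Finset.sum_add_distrib]
    ring
  map_smul' r y := by
    ext i
    simp only [Pi.smul_apply, smul_eq_mul, ← Finset.mul_sum, RingHom.id_apply]
    ring

lemma projL_apply (g : ℕ) (y : Fin (g + 1) → ℝ) (i : Fin g) :
    projL g y i = y i.succ - (∑ j, y j) / ((g : ℝ) + 1) := rfl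

lemma int_aux (y : ℝ) (h1 : -(1 / 2) ≤ y) (h2 : y ≤ 1 / 2) (c : ℤ) :
    0 ≤ (c : ℝ) ^ 2 - 2 * y * c := by
  rcases lt_trichotomy c 0 with h | h | h
  · have : (c : ℝ) ≤ -1 := by exact_mod_cast (by omega : c ≤ -1)
    nlinarith
  · simp [h]
  · have : (1 : ℝ) ≤ c := by exact_mod_cast (by omega : 1 ≤ c)
    nlinarith

lemma projL_sum (g : ℕ) (y : Fin (g + 1) → ℝ) :
    ∑ i, projL g y i = (∑ j, y j) / ((g : ℝ) + 1) - y 0 := by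
  have hg : (g : ℝ) + 1 ≠ 0 := by positivity
  simp only [projL_apply, Finset.sum_sub_distrib, Finset.sum_const, Finset.card_univ,
    Fintype.card_fin, nsmul_eq_mul, Fin.sum_univ_succ y]
  field_simp
  ring

lemma cube_mem (g : ℕ) (y : Fin (g + 1) → ℝ) (h : ∀ j, -(1 / 2) ≤ y j ∧ y j ≤ 1 / 2) :
    projL g y ∈ voronoiPolytope (bananaQ g) := by
  intro c
  rw [← sub_nonneg, qf_sub_s5, projL_sum]
  have e : ∑ i, ((c i : ℝ) ^ 2 - 2 * projL g y i * c i) =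
      ∑ i, ((c i : ℝ) ^ 2 - 2 * y i.succ * c i)
        + 2 * ((∑ j, y j) / ((g : ℝ) + 1)) * ∑ i, (c i : ℝ) := by
    rw [Finset.mul_sum, ← Finset.sum_add_distrib]
    exact Finset.sum_congr rfl fun i _ => by rw [projL_apply]; ring
  have h1 : 0 ≤ ∑ i, ((c i : ℝ) ^ 2 - 2 * y i.succ * c i) :=
    Finset.sum_nonneg fun i _ => int_aux _ (h _).1 (h _).2 _
  have h2 := int_aux (y 0) (h 0).1 (h 0).2 (-∑ i, c i)
  push_cast at h2
  rw [e]
  linarith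

lemma vor_ineq {g : ℕ} {a : Fin g → ℝ} (ha : a ∈ voronoiPolytope (bananaQ g)) (i : Fin g) :
    a i + ∑ j, a j ≤ 1 ∧ -1 ≤ a i + ∑ j, a j ∧ ∀ j, a i - a j ≤ 1 := by
  have key : ∀ c : Fin g → ℤ, 0 ≤ ∑ i, ((c i : ℝ) ^ 2 - 2 * a i * c i) + ((∑ i, (c i : ℝ)) ^ 2
        - 2 * (∑ i, a i) * ∑ i, (c i : ℝ)) := by
    intro c
    rw [← qf_sub_s5, sub_nonneg]
    exact ha c
  simp only [Finset.sum_sub_distrib] at key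
  refine ⟨?_, ?_, ?_⟩
  · have := key (Pi.single i 1)
    simp [Pi.single_apply] at this
    linarith
  · have := key (-Pi.single i 1)
    simp [Pi.single_apply] at this
    linarith
  · intro j
    by_cases hij : i = j
    · simp [hij]
    have := key (Pi.single i 1 - Pi.single j 1)
    simp [Pi.single_apply, sub_sq, mul_sub, Finset.sum_sub_distrib, Finset.sum_add_distrib, hij,
      Ne.symm hij] at this
    linarith

lemma vor_eq (g : ℕ) : voronoiPolytope (bananaQ g) =
    projL g '' {y | ∀ j, -(1 / 2) ≤ y j ∧ y j ≤ 1 / 2} := by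
  ext a
  constructor
  · intro ha
    let x : Fin (g + 1) → ℝ := Fin.cons (-∑ j, a j) a
    have hx : ∀ i j, x i - x j ≤ 1 := by
      intro i j
      refine Fin.cases ?_ (fun i => ?_) i <;> refine Fin.cases ?_ (fun j => ?_) j <;>
        simp only [x, Fin.cons_zero, Fin.cons_succ]
      · norm_num
      · linarith [(vor_ineq ha j).2.1]
      · linarith [(vor_ineq ha i).1]
      · exact (vor_ineq ha i).2.2 j
    obtain ⟨m, hm⟩ := Finite.exists_max x
    refine ⟨fun j => x j - (x m - 1 / 2), fun j => ⟨?_, ?_⟩, ?_⟩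
    · linarith [hx m j]
    · linarith [hm j]
    · ext i
      have hs : ∑ j, x j = 0 := by simp [x, Fin.sum_univ_succ]
      have hg : (g : ℝ) + 1 ≠ 0 := by positivity
      have hxi : x i.succ = a i := by simp [x]
      rw [projL_apply]
      simp only [Finset.sum_sub_distrib, hs, hxi, Finset.sum_const, Finset.card_univ,
        Fintype.card_fin, nsmul_eq_mul]
      push_cast
      field_simp
      ring
  · rintro ⟨y, hy, rfl⟩
    exact cube_mem g y hy

lemma vor_hull (g : ℕ) : voronoiPolytope (bananaQ g) =
    convexHull ℝ (projL g '' (Set.univ.pi fun _ => {-(1 / 2), 1 / 2})) := by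
  rw [vor_eq, ← LinearMap.image_convexHull, convexHull_pi]
  congr 1
  ext y
  simp only [convexHull_pair, Set.mem_pi, Set.mem_univ, true_imp_iff, Set.mem_setOf_eq]
  rw [segment_eq_Icc (by norm_num)]
  rfl

lemma zero_not_extreme (g : ℕ) (hg : 1 ≤ g) :
    (0 : Fin g → ℝ) ∉ Set.extremePoints ℝ (voronoiPolytope (bananaQ g)) := by
  intro h
  have hp : projL g (Pi.single 0 (1 / 2)) ∈ voronoiPolytope (bananaQ g) := by
    apply cube_mem
    intro j
    by_cases hj : j = 0 <;> simp [Pi.single_apply, hj] <;> norm_num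
  have hn : projL g (-Pi.single 0 (1 / 2)) ∈ voronoiPolytope (bananaQ g) := by
    apply cube_mem
    intro j
    by_cases hj : j = 0 <;> simp [Pi.single_apply, hj] <;> norm_num
  have h0 := h.2 hp hn ⟨1 / 2, 1 / 2, by norm_num, by norm_num, by norm_num, by
    rw [map_neg, smul_neg, add_neg_cancel]⟩
  have h1 := congrFun h0 ⟨0, hg⟩
  have hg' : (g : ℝ) + 1 ≠ 0 := by positivity
  rw [projL_apply, Finset.sum_pi_single', Pi.single_eq_of_ne (Fin.succ_ne_zero _)] at h1
  simp only [Finset.mem_univ, if_true, Pi.zero_apply, zero_sub, neg_eq_zero, div_eq_zero_iff,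
    hg', or_false] at h1
  norm_num at h1

lemma extreme_class (g : ℕ) (hg : 1 ≤ g) (a : Fin g → ℝ)
    (ha : a ∈ Set.extremePoints ℝ (voronoiPolytope (bananaQ g))) :
    ∃ k, 1 ≤ k ∧ k ≤ g ∧ a ∈ bananaClass g k := by
  have ha2 := ha
  rw [vor_hull] at ha2
  obtain ⟨y, hy, rfl⟩ := extremePoints_convexHull_subset ha2
  have hy : ∀ j, y j = -(1 / 2) ∨ y j = 1 / 2 := by simpa [Set.mem_pi] using hy
  classical
  let S : Finset (Fin (g + 1)) := Finset.univ.filter fun j => y j = 1 / 2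
  have hg' : (g : ℝ) + 1 ≠ 0 := by positivity
  have hyS : ∀ j, y j = (if y j = 1 / 2 then 1 else 0) - 1 / 2 := by
    intro j
    rcases hy j with h | h <;> rw [h] <;> norm_num
  have hsum : ∑ j, y j = S.card - ((g : ℝ) + 1) / 2 := by
    rw [Finset.sum_congr rfl fun j _ => hyS j]
    simp only [Finset.sum_sub_distrib, Finset.sum_boole, S, Finset.sum_const, Finset.card_univ,
        Fintype.card_fin, nsmul_eq_mul]
    push_cast
    ring
  have hval : ∀ i, projL g y i = y i.succ + 1 / 2 - S.card / ((g : ℝ) + 1) := by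
    intro i
    rw [projL_apply, hsum]
    field_simp
    ring
  have hcard : S.card = (if y 0 = 1 / 2 then 1 else 0) +
      (Finset.univ.filter fun i : Fin g => y i.succ = 1 / 2).card := by
    simp only [S, Finset.card_filter, Fin.sum_univ_succ]
  have hiff : ∀ i, projL g y i = ((g : ℝ) + 1 - (S.card : ℝ)) / ((g : ℝ) + 1) ↔
      y i.succ = 1 / 2 := by
    intro i
    rw [hval, sub_div, div_self hg']
    constructor <;> intro h <;> linarith
  refine ⟨S.card, ?_, ?_, ?_, ?_⟩
  · by_contra hlt
    have h0 : S.card = 0 := by omega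
    apply zero_not_extreme g hg
    convert ha using 1
    ext i
    rw [hval, h0]
    have : i.succ ∉ S := by rw [Finset.card_eq_zero.1 h0]; simp
    have h2 : y i.succ ≠ 1 / 2 := by simpa [S] using this
    rw [(hy i.succ).resolve_right h2]
    simp
  · by_contra hlt
    have hle : S.card ≤ g + 1 := by simpa using S.card_le_univ
    have h0 : S.card = g + 1 := by omega
    apply zero_not_extreme g hg
    convert ha using 1
    ext i
    have hu : S = Finset.univ := by
      rw [← Finset.card_eq_iff_eq_univ]; simpa using h0
    have : i.succ ∈ S := by rw [hu]; simp
    have h2 : y i.succ = 1 / 2 := by simpa [S] using this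
    rw [hval, h0, h2]
    push_cast
    rw [div_self hg']
    norm_num
  · intro i
    rcases hy i.succ with h | h
    · left
      rw [hval, h]
      ring
    · right
      exact (hiff i).2 h
  · have : {i | projL g y i = ((g : ℝ) + 1 - (S.card : ℝ)) / ((g : ℝ) + 1)} =
        ((Finset.univ.filter fun i : Fin g => y i.succ = 1 / 2 : Finset (Fin g)) :
          Set (Fin g)) := by
      ext i
      simp only [Set.mem_setOf_eq, hiff]
      simp
    rw [this, Set.ncard_coe_finset]
    split_ifs at hcard <;> omega

lemma class_mod {g k : ℕ} {a : Fin g → ℝ} (h : a ∈ bananaClass g k) (i : Fin g) :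
    ∃ z : ℤ, a i = z - k / ((g : ℝ) + 1) := by
  have hg' : (g : ℝ) + 1 ≠ 0 := by positivity
  rcases h.1 i with h | h
  · exact ⟨0, by rw [h]; push_cast; ring⟩
  · exact ⟨1, by rw [h, sub_div, div_self hg']; push_cast; ring⟩

/-- Two Voronoi vertices `a, a'` of the banana graph are equivalent (`a' = a − c₀` for some
`c₀ ∈ 𝒟(a)`) iff they lie in a common class `[k]`, `k ∈ {1,…,g}`. -/
theorem stmt5 (g : ℕ) (hg : 1 ≤ g) (a a' : Fin g → ℝ)
    (ha : a ∈ Set.extremePoints ℝ (voronoiPolytope (bananaQ g)))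
    (ha' : a' ∈ Set.extremePoints ℝ (voronoiPolytope (bananaQ g))) :
    (∃ c₀ ∈ delaunaySet (bananaQ g) a, a' = a - intVec c₀) ↔
      ∃ k ∈ Finset.Icc 1 g, a ∈ bananaClass g k ∧ a' ∈ bananaClass g k := by
  constructor
  · rintro ⟨c, -, hc⟩
    obtain ⟨k, hk1, hk2, hk⟩ := extreme_class g hg a ha
    obtain ⟨l, hl1, hl2, hl⟩ := extreme_class g hg a' ha'
    obtain ⟨z, hz⟩ := class_mod hk ⟨0, hg⟩
    obtain ⟨w, hw⟩ := class_mod hl ⟨0, hg⟩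
    have h0 := congrFun hc ⟨0, hg⟩
    simp only [Pi.sub_apply, intVec] at h0
    rw [hz, hw] at h0
    have hg' : (g : ℝ) + 1 ≠ 0 := by positivity
    have h1 : ((k : ℝ) - l) = ((z - c ⟨0, hg⟩ - w : ℤ) : ℝ) * ((g : ℝ) + 1) := by
      push_cast
      field_simp at h0
      linarith
    have h2 : (k : ℤ) - l = (z - c ⟨0, hg⟩ - w) * ((g : ℤ) + 1) := by exact_mod_cast h1
    have h3 : (k : ℤ) - l = 0 := by
      apply Int.eq_zero_of_abs_lt_dvd (m := (g : ℤ) + 1) (Dvd.intro_left _ h2.symm)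
      rw [abs_lt]
      constructor <;> omega
    have h4 : k = l := by omega
    subst h4
    exact ⟨k, Finset.mem_Icc.2 ⟨hk1, hk2⟩, hk, hl⟩
  · rintro ⟨k, -, hk, hl⟩
    choose z hz using class_mod hk
    choose w hw using class_mod hl
    have e : a' = a - intVec (fun i => z i - w i) := by
      ext i
      simp only [Pi.sub_apply, intVec, hz, hw]
      push_cast
      ring
    have e' : a = a' - intVec (fun i => w i - z i) := by
      ext i
      simp only [Pi.sub_apply, intVec, hz, hw]
      push_cast
      ring
    refine ⟨_, ?_, e⟩
    have h1 := ha.1 (fun i => z i - w i)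
    have h2 := ha'.1 (fun i => w i - z i)
    rw [← e'] at h2
    rw [← e] at h1
    show quadForm _ _ = quadForm _ _
    rw [← e]
    exact le_antisymm h1 h2
end

section
/- Let Q be the tropical Riemann matrix of the genus-g banana graph and let π' be the n×n real matrix with diagonal entries g/(g+1) and all off-diagonal entries −1/(g+1). Then the image {Bᵀa : a ∈ V_Q} equals the image {π'v : v ∈ [−1/2, 1/2]^n} of the n-dimensional cube under π'. Moreover, the extreme points of this set are exactly the vectors in ℝ^n which, for some k ∈ {1,…,g}, have exactly n−k coordinates equal to k/(g+1) and exactly k coordinates equal to −(g+1−k)/(g+1). -/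
open Matrix

/-- The projection matrix `π'` with diagonal entries `g/(g+1)` and off-diagonal entries
`−1/(g+1)`. -/
noncomputable def piMat (g : ℕ) : Matrix (Fin (g + 1)) (Fin (g + 1)) ℝ :=
  Matrix.of fun i j => if i = j then (g : ℝ) / ((g : ℝ) + 1) else -1 / ((g : ℝ) + 1)

def bananaP (g : ℕ) : Set (Fin (g + 1) → ℝ) :=
  {x | ∑ i, x i = 0 ∧ ∀ i j, x i - x j ≤ 1}

lemma bananaBT_zero (g : ℕ) (a : Fin g → ℝ) : bananaBT g a 0 = ∑ i, a i := by
  simp [bananaBT]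

lemma bananaBT_succ (g : ℕ) (a : Fin g → ℝ) (i : Fin g) : bananaBT g a i.succ = - a i := by
  simp [bananaBT, ← Fin.ext_iff]

lemma bananaBT_sum (g : ℕ) (a : Fin g → ℝ) : ∑ j, bananaBT g a j = 0 := by
  rw [Fin.sum_univ_succ]
  simp [bananaBT_zero, bananaBT_succ]

lemma bananaBT_inv (g : ℕ) (y : Fin (g + 1) → ℝ) (hy : ∑ j, y j = 0) :
    bananaBT g (fun i => - y i.succ) = y := by
  rw [Fin.sum_univ_succ] at hy
  funext j
  refine Fin.cases ?_ (fun i => ?_) j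
  · rw [bananaBT_zero, Finset.sum_neg_distrib]; linarith
  · rw [bananaBT_succ, neg_neg]

lemma bananaBT_sub (g : ℕ) (a b : Fin g → ℝ) (j : Fin (g + 1)) :
    bananaBT g (a - b) j = bananaBT g a j - bananaBT g b j := by
  simp only [bananaBT, Pi.sub_apply, mul_sub, Finset.sum_sub_distrib]

lemma quadForm_banana (g : ℕ) (a : Fin g → ℝ) :
    quadForm (bananaQ g) a = ∑ j, (bananaBT g a j) ^ 2 := by
  rw [Fin.sum_univ_succ, bananaBT_zero]
  simp only [bananaBT_succ]
  have h : ∀ i, (bananaQ g).mulVec a i = a i + ∑ j, a j := by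
    intro i
    simp only [Matrix.mulVec, dotProduct, bananaQ, Matrix.of_apply]
    have : ∀ j, (if i = j then (2:ℝ) else 1) * a j = (if i = j then a j else 0) + a j := by
      intro j; split_ifs <;> ring
    simp only [this, Finset.sum_add_distrib]
    simp
  simp only [quadForm, dotProduct, h, mul_add, Finset.sum_add_distrib, ← Finset.sum_mul]
  rw [sq, add_comm]
  congr 1
  exact Finset.sum_congr rfl fun i _ => by ring

/-- centering constant -/
lemma bananaP_center (g : ℕ) (x : Fin (g + 1) → ℝ) (hx : ∀ i j, x i - x j ≤ 1) :
    ∃ s : ℝ, ∀ i, -(1:ℝ) / 2 ≤ x i - s ∧ x i - s ≤ 1 / 2 := by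
  obtain ⟨p, -, hp⟩ := Finset.exists_max_image Finset.univ x ⟨0, Finset.mem_univ _⟩
  obtain ⟨q, -, hq⟩ := Finset.exists_min_image Finset.univ x ⟨0, Finset.mem_univ _⟩
  refine ⟨(x p + x q) / 2, fun i => ?_⟩
  have h1 := hp i (Finset.mem_univ _)
  have h2 := hq i (Finset.mem_univ _)
  have h3 := hx p q
  constructor <;> linarith

lemma int_term (u : ℝ) (z : ℤ) (h1 : -(1:ℝ) / 2 ≤ u) (h2 : u ≤ 1 / 2) :
    0 ≤ (z : ℝ) ^ 2 - 2 * u * z := by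
  rcases lt_trichotomy z 0 with h | h | h
  · have : (z : ℝ) ≤ -1 := by exact_mod_cast (by omega : z ≤ -1)
    nlinarith
  · simp [h]
  · have : (1 : ℝ) ≤ z := by exact_mod_cast (by omega : 1 ≤ z)
    nlinarith

lemma banana_image (g : ℕ) : bananaBT g '' voronoiPolytope (bananaQ g) = bananaP g := by
  ext x
  constructor
  · rintro ⟨a, ha, rfl⟩
    refine ⟨bananaBT_sum g a, fun i j => ?_⟩
    by_cases hij : i = j
    · simp [hij]
    let y : Fin (g + 1) → ℤ := fun l => (if l = i then 1 else 0) - (if l = j then 1 else 0)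
    have hy : ∑ l, (y l : ℝ) = 0 := by simp [y]
    have hc : bananaBT g (intVec fun l => - y l.succ) = fun l => (y l : ℝ) := by
      rw [← bananaBT_inv g (fun l => (y l : ℝ)) hy]
      congr 1
      funext l
      simp [intVec]
    have h := ha (fun l => - y l.succ)
    rw [quadForm_banana, quadForm_banana] at h
    simp only [bananaBT_sub, hc] at h
    have h2 : ∑ l, (bananaBT g a l - (y l : ℝ)) ^ 2 - ∑ l, (bananaBT g a l) ^ 2
        = 2 - 2 * (bananaBT g a i - bananaBT g a j) := by
      rw [← Finset.sum_sub_distrib]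
      have : ∀ l, (bananaBT g a l - (y l : ℝ)) ^ 2 - (bananaBT g a l) ^ 2
          = (if l = i then 1 - 2 * bananaBT g a l else 0)
            + (if l = j then 1 + 2 * bananaBT g a l else 0) := by
        intro l
        by_cases h1 : l = i
        · have : l ≠ j := fun h => hij (h1 ▸ h)
          simp [y, h1, hij]; ring
        · by_cases h2 : l = j
          · have : j ≠ i := fun h => hij h.symm
            simp [y, h2, this]; ring
          · simp [y, h1, h2]
      simp only [this, Finset.sum_add_distrib]
      simp
      ring
    linarith
  · rintro ⟨hs, hx⟩
    refine ⟨fun i => - x i.succ, ?_, bananaBT_inv g x hs⟩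
    intro c
    rw [quadForm_banana, quadForm_banana]
    simp only [bananaBT_sub, bananaBT_inv g x hs]
    obtain ⟨s, hsx⟩ := bananaP_center g x hx
    have hz : ∀ j, ∃ z : ℤ, bananaBT g (intVec c) j = z := by
      intro j
      refine Fin.cases ?_ (fun i => ?_) j
      · exact ⟨∑ i, c i, by rw [bananaBT_zero]; simp [intVec]⟩
      · exact ⟨- c i, by rw [bananaBT_succ]; simp [intVec]⟩
    have h0 := bananaBT_sum g (intVec c)
    generalize bananaBT g (intVec c) = y at *
    have key : ∑ j, (x j - y j) ^ 2 - ∑ j, x j ^ 2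
        = ∑ j, (y j ^ 2 - 2 * (x j - s) * y j) - 2 * s * ∑ j, y j := by
      rw [Finset.mul_sum, ← Finset.sum_sub_distrib, ← Finset.sum_sub_distrib]
      exact Finset.sum_congr rfl fun j _ => by ring
    have : 0 ≤ ∑ j, (y j ^ 2 - 2 * (x j - s) * y j) := by
      refine Finset.sum_nonneg fun j _ => ?_
      obtain ⟨z, hz⟩ := hz j
      rw [hz]
      exact int_term _ z (hsx j).1 (hsx j).2
    rw [h0] at key
    linarith

lemma piMat_mulVec (g : ℕ) (v : Fin (g + 1) → ℝ) (i : Fin (g + 1)) :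
    (piMat g).mulVec v i = v i - (∑ j, v j) / ((g : ℝ) + 1) := by
  have hg : (g : ℝ) + 1 ≠ 0 := by positivity
  simp only [Matrix.mulVec, dotProduct, piMat, Matrix.of_apply]
  have : ∀ j, (if i = j then (g : ℝ) / ((g : ℝ) + 1) else -1 / ((g : ℝ) + 1)) * v j
      = (if i = j then v j else 0) - v j / ((g : ℝ) + 1) := by
    intro j; split_ifs <;> field_simp <;> ring
  simp only [this, Finset.sum_sub_distrib, ← Finset.sum_div]
  simp

lemma piMat_image (g : ℕ) : (piMat g).mulVec ''
    {v : Fin (g + 1) → ℝ | ∀ i, v i ∈ Set.Icc (-(1 : ℝ) / 2) (1 / 2)} = bananaP g := by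
  have hg : (g : ℝ) + 1 ≠ 0 := by positivity
  ext x
  constructor
  · rintro ⟨v, hv, rfl⟩
    refine ⟨?_, fun i j => ?_⟩
    · simp only [piMat_mulVec, Finset.sum_sub_distrib]
      simp
      field_simp
      ring
    · rw [piMat_mulVec, piMat_mulVec]
      have h1 := (hv i).2
      have h2 := (hv j).1
      linarith
  · rintro ⟨hs, hx⟩
    obtain ⟨s, hsx⟩ := bananaP_center g x hx
    refine ⟨fun i => x i - s, fun i => ⟨(hsx i).1, (hsx i).2⟩, ?_⟩
    funext i
    rw [piMat_mulVec, Finset.sum_sub_distrib, hs]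
    simp
    field_simp
    try ring

lemma extreme_tight (g : ℕ) (hg : 1 ≤ g) (x : Fin (g + 1) → ℝ)
    (hx : x ∈ Set.extremePoints ℝ (bananaP g)) (i : Fin (g + 1)) :
    ∃ j, x i - x j = 1 ∨ x j - x i = 1 := by
  have hg0 : (g : ℝ) + 1 ≠ 0 := by positivity
  by_contra hcon
  push Not at hcon
  obtain ⟨⟨hs, hd⟩, hext⟩ := mem_extremePoints.1 hx
  obtain ⟨p, -, hp⟩ := Finset.exists_max_image Finset.univ (fun j => |x i - x j|)
    ⟨0, Finset.mem_univ _⟩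
  set e : ℝ := 1 - |x i - x p| with he
  have hb : ∀ j, |x i - x j| ≤ 1 - e := fun j => by
    have := hp j (Finset.mem_univ _)
    linarith
  have epos : 0 < e := by
    have h1 := lt_of_le_of_ne (hd i p) (hcon p).1
    have h2 := lt_of_le_of_ne (hd p i) (hcon p).2
    have : |x i - x p| < 1 := abs_lt.2 ⟨by linarith, h1⟩
    linarith
  let y : ℝ → Fin (g + 1) → ℝ := fun t j => x j + t * ((if j = i then 1 else 0) - 1 / ((g : ℝ) + 1))
  have hy : ∀ t, |t| ≤ e → y t ∈ bananaP g := by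
    intro t ht
    refine ⟨?_, fun a b => ?_⟩
    · simp only [y, Finset.sum_add_distrib, hs, ← Finset.mul_sum, Finset.sum_sub_distrib]
      simp
      field_simp
      try simp
    · have ht' := abs_le.1 ht
      have h1 := abs_le.1 (hb a)
      have h2 := abs_le.1 (hb b)
      have h3 := hd a b
      simp only [y]
      by_cases ha : a = i <;> by_cases hb' : b = i
      · simp [ha, hb']
      · simp only [ha, hb', if_true, if_false]; linarith
      · simp only [ha, hb', if_true, if_false]; linarith
      · simp only [ha, hb', if_false]; linarith
  have h1 := hy e (by rw [abs_of_pos epos])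
  have h2 := hy (-e) (by rw [abs_neg, abs_of_pos epos])
  have h3 := (hext _ h1 _ h2 ⟨1/2, 1/2, by norm_num, by norm_num, by norm_num, by
    funext j; simp [y]; ring⟩).1
  have h4 := congrFun h3 i
  simp only [y, if_true] at h4
  have h5 : (1:ℝ) - 1 / ((g : ℝ) + 1) ≠ 0 := by
    have : (1:ℝ) ≤ g := by exact_mod_cast hg
    intro h
    field_simp at h
    linarith
  have : e * (1 - 1 / ((g : ℝ) + 1)) = 0 := by linarith
  rcases mul_eq_zero.1 this with h | h
  · exact epos.ne' h
  · exact h5 h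

lemma two_val_extreme (g : ℕ) (x : Fin (g + 1) → ℝ) (t : ℝ) (hs : ∑ j, x j = 0)
    (hv : ∀ j, x j = t ∨ x j = t - 1) (hp : ∃ p, x p = t) (hq : ∃ q, x q = t - 1) :
    x ∈ Set.extremePoints ℝ (bananaP g) := by
  obtain ⟨p, hp⟩ := hp
  obtain ⟨q, hq⟩ := hq
  rw [mem_extremePoints_iff_left]
  refine ⟨⟨hs, fun i j => ?_⟩, ?_⟩
  · rcases hv i with h | h <;> rcases hv j with h' | h' <;> rw [h, h'] <;> linarith
  rintro y ⟨hys, hyd⟩ z ⟨-, hzd⟩ ⟨a, b, ha, hb, hab, rfl⟩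
  simp only [Pi.add_apply, Pi.smul_apply, smul_eq_mul] at *
  have key : ∀ i j, a * y i + b * z i = t → a * y j + b * z j = t - 1 → y i - y j = 1 := by
    intro i j hi hj
    have h1 := hyd i j
    have h2 := hzd i j
    have h3 : a * (y i - y j) + b * (z i - z j) = 1 := by linarith
    nlinarith
  have hc : ∀ j, y j - (a * y j + b * z j) = y p - t := by
    intro j
    have h0 := key p q hp hq
    rcases hv j with h | h
    · have := key j q h hq
      rw [h]; linarith
    · have := key p j hp h
      rw [h]; linarith
  have hsum : ∑ j, (y j - (a * y j + b * z j)) = 0 := by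
    rw [Finset.sum_sub_distrib, hs, hys, sub_zero]
  rw [Finset.sum_congr rfl fun j _ => hc j] at hsum
  have h0 : y p - t = 0 := by
    rw [Finset.sum_const, Finset.card_univ, Fintype.card_fin, nsmul_eq_mul] at hsum
    rcases mul_eq_zero.1 hsum with h | h
    · exact absurd h (Nat.cast_ne_zero.2 (Nat.succ_ne_zero g))
    · exact h
  funext j
  have := hc j
  simp only [Pi.add_apply, Pi.smul_apply, smul_eq_mul]
  linarith

lemma two_val_sum (g : ℕ) (x : Fin (g + 1) → ℝ) (t : ℝ)
    (hv : ∀ j, x j = t ∨ x j = t - 1) :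
    ∑ j, x j = ((g : ℝ) + 1) * t - ({j | x j = t - 1}.ncard : ℝ) := by
  classical
  have : ∀ j, x j = t - (if x j = t - 1 then 1 else 0) := by
    intro j
    split_ifs with h
    · exact h
    · rcases hv j with h' | h'
      · linarith
      · exact absurd h' h
  rw [Finset.sum_congr rfl fun j _ => this j, Finset.sum_sub_distrib, Finset.sum_boole,
    Set.ncard_eq_toFinset_card']
  simp

lemma compl_ncard (g : ℕ) (x : Fin (g + 1) → ℝ) (t : ℝ) :
    {j | x j = t}.ncard + {j | x j = t - 1}.ncard
      = ({j | x j = t} ∪ {j | x j = t - 1}).ncard := by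
  rw [Set.ncard_union_eq]
  rw [Set.disjoint_left]
  intro j h1 h2
  simp only [Set.mem_ofPred_eq] at h1 h2
  linarith

/-- `Bᵀ(V_Q)` is the image of the cube `[−1/2, 1/2]^{g+1}` under `π'`, and its extreme points
are exactly the vectors having, for some `k ∈ {1,…,g}`, exactly `n−k` coordinates equal to
`k/(g+1)` and exactly `k` coordinates equal to `−(g+1−k)/(g+1)`. -/
theorem stmt6 (g : ℕ) (hg : 1 ≤ g) :
    (bananaBT g '' voronoiPolytope (bananaQ g) =
      (piMat g).mulVec '' {v : Fin (g + 1) → ℝ | ∀ i, v i ∈ Set.Icc (-(1 : ℝ) / 2) (1 / 2)}) ∧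
    Set.extremePoints ℝ (bananaBT g '' voronoiPolytope (bananaQ g)) =
      {x : Fin (g + 1) → ℝ | ∃ k : ℕ, 1 ≤ k ∧ k ≤ g ∧
        {j | x j = (k : ℝ) / ((g : ℝ) + 1)}.ncard = (g + 1) - k ∧
        {j | x j = -(((g : ℝ) + 1 - (k : ℝ)) / ((g : ℝ) + 1))}.ncard = k} := by
  rw [banana_image, piMat_image]
  refine ⟨rfl, ?_⟩
  have hg0 : (g : ℝ) + 1 ≠ 0 := by positivity
  have hk : ∀ k : ℕ, -(((g : ℝ) + 1 - (k : ℝ)) / ((g : ℝ) + 1)) = (k : ℝ) / ((g : ℝ) + 1) - 1 := by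
    intro k; field_simp; ring
  simp only [hk]
  ext x
  constructor
  · intro hx
    have ht := extreme_tight g hg x hx
    obtain ⟨hs, hd⟩ := hx.1
    obtain ⟨p, -, hp⟩ := Finset.exists_max_image Finset.univ x ⟨0, Finset.mem_univ _⟩
    have hp' : ∀ j, x j ≤ x p := fun j => hp j (Finset.mem_univ _)
    obtain ⟨q, hq⟩ : ∃ q, x q = x p - 1 := by
      obtain ⟨q, h | h⟩ := ht p
      · exact ⟨q, by linarith⟩
      · have := hp' q; linarith
    have hv : ∀ j, x j = x p ∨ x j = x p - 1 := by
      intro j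
      obtain ⟨l, h | h⟩ := ht j
      · left
        have h1 := hd p l
        have h2 := hp' j
        linarith
      · right
        have h1 := hd p j
        have h2 := hp' l
        linarith
    have hsum := two_val_sum g x (x p) hv
    have hcc := compl_ncard g x (x p)
    have hU : ({j | x j = x p} ∪ {j | x j = x p - 1}) = Set.univ := by
      ext j; simpa using hv j
    rw [hU, Set.ncard_univ, Nat.card_eq_fintype_card, Fintype.card_fin] at hcc
    have h1 : 0 < {j | x j = x p}.ncard := (Set.ncard_pos).2 ⟨p, rfl⟩
    have h2 : 0 < {j | x j = x p - 1}.ncard := (Set.ncard_pos).2 ⟨q, hq⟩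
    refine ⟨{j | x j = x p - 1}.ncard, h2, by omega, ?_⟩
    have hxp : (({j | x j = x p - 1}.ncard : ℕ) : ℝ) / ((g : ℝ) + 1) = x p := by
      rw [div_eq_iff hg0]; linarith
    rw [hxp]
    exact ⟨by omega, rfl⟩
  · rintro ⟨k, hk1, hkg, h1, h2⟩
    have hcc := compl_ncard g x ((k : ℝ) / ((g : ℝ) + 1))
    have hU : ({j | x j = (k : ℝ) / ((g : ℝ) + 1)} ∪ {j | x j = (k : ℝ) / ((g : ℝ) + 1) - 1})
        = Set.univ := by
      apply Set.eq_of_subset_of_ncard_le (Set.subset_univ _)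
      rw [Set.ncard_univ, Nat.card_eq_fintype_card, Fintype.card_fin]
      omega
    have hv : ∀ j, x j = (k : ℝ) / ((g : ℝ) + 1) ∨ x j = (k : ℝ) / ((g : ℝ) + 1) - 1 := by
      intro j
      have : j ∈ (Set.univ : Set (Fin (g + 1))) := Set.mem_univ j
      rw [← hU] at this
      exact this
    have hsum := two_val_sum g x _ hv
    rw [h2] at hsum
    refine two_val_extreme g x _ ?_ hv ?_ ?_
    · rw [hsum]; field_simp; ring
    · obtain ⟨j, hj⟩ := (Set.ncard_pos).1 (lt_of_lt_of_eq (by omega) h1.symm)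
      exact ⟨j, hj⟩
    · obtain ⟨j, hj⟩ := (Set.ncard_pos).1 (lt_of_lt_of_eq (by omega) h2.symm)
      exact ⟨j, hj⟩
end

section
/- Let Q be the tropical Riemann matrix of the genus-g banana graph, let k ∈ {1,…,g}, and let a ∈ [k] be an extreme point of V_Q. Then Bᵀa has no zero coordinate; define s_a ∈ {0,1}^n by (s_a)_j = 0 if (Bᵀa)_j > 0 and (s_a)_j = 1 if (Bᵀa)_j < 0. Then {Bᵀc + s_a : c ∈ 𝒟(a)} = {x ∈ {0,1}^n : x₁ + ⋯ + x_n = k}, the vertex set of the hypersimplex Δ_{k,n}. In particular, the cardinality of 𝒟(a) equals the binomial coefficient C(g+1, k). -/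
open Matrix

theorem bt_zero (g : ℕ) (v : Fin g → ℝ) : bananaBT g v 0 = ∑ i, v i := by
  simp [bananaBT]

theorem bt_succ (g : ℕ) (v : Fin g → ℝ) (i : Fin g) : bananaBT g v i.succ = - v i := by
  have h : ∀ x : Fin g, ((i : ℕ) = (x : ℕ)) ↔ i = x := fun x => by rw [Fin.ext_iff]
  simp [bananaBT, h]

theorem quad_eq (g : ℕ) (v : Fin g → ℝ) :
    quadForm (bananaQ g) v = ∑ j, (bananaBT g v j) ^ 2 := by
  rw [Fin.sum_univ_succ, bt_zero]
  simp only [bt_succ]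
  have h : ∀ i, (bananaQ g).mulVec v i = (∑ j, v j) + v i := by
    intro i
    have h1 : ∀ j, bananaQ g i j * v j = v j + if i = j then v j else 0 := by
      intro j
      simp only [bananaQ, Matrix.of_apply]
      split_ifs <;> ring
    simp only [Matrix.mulVec, dotProduct, h1, Finset.sum_add_distrib]
    simp
  simp only [quadForm, dotProduct, h, mul_add, Finset.sum_add_distrib, ← Finset.sum_mul]
  simp [pow_two]

theorem bt_sub (g : ℕ) (v w : Fin g → ℝ) (j : Fin (g + 1)) :
    bananaBT g (v - w) j = bananaBT g v j - bananaBT g w j := by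
  simp [bananaBT, mul_sub]

theorem bt_sum (g : ℕ) (v : Fin g → ℝ) : ∑ j, bananaBT g v j = 0 := by
  rw [Fin.sum_univ_succ, bt_zero]
  simp [bt_succ]

theorem exists_s (g k : ℕ) (hk1 : 1 ≤ k)
    (a : Fin g → ℝ) (hak : a ∈ bananaClass g k) :
    ∃ s : Fin (g + 1) → ℤ, (∀ j, s j = 0 ∨ s j = 1) ∧ ∑ j, s j = k ∧
      ∀ j, bananaBT g a j = (k : ℝ) / ((g : ℝ) + 1) - s j := by
  classical
  obtain ⟨h1, h2⟩ := hak
  have hn : (g : ℝ) + 1 ≠ 0 := by positivity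
  set t : ℝ := ((g : ℝ) + 1 - (k : ℝ)) / ((g : ℝ) + 1) with ht
  set e : Fin g → ℤ := fun i => if a i = t then 1 else 0 with he
  have hcard : ∑ i, e i = (({i | a i = t}.ncard : ℕ) : ℤ) := by
    have : {i | a i = t} = ((Finset.univ.filter fun i => a i = t : Finset (Fin g)) : Set (Fin g)) := by
      ext; simp
    rw [this, Set.ncard_coe_finset]
    simp [he]
  have hae : ∀ i, a i = (e i : ℝ) - (k : ℝ) / ((g : ℝ) + 1) := by
    intro i
    simp only [he]
    split_ifs with h
    · rw [h, ht]; push_cast; field_simp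
    · rcases h1 i with h' | h'
      · rw [h']; push_cast; ring
      · exact absurd h' h
  refine ⟨Fin.cons ((k : ℤ) - ∑ i, e i) e, ?_, ?_, ?_⟩
  · intro j
    refine Fin.cases ?_ (fun i => ?_) j
    · simp only [Fin.cons_zero, hcard]; omega
    · simp only [Fin.cons_succ, he]; split_ifs <;> simp
  · rw [Fin.sum_univ_succ]; simp
  · intro j
    refine Fin.cases ?_ (fun i => ?_) j
    · rw [bt_zero]
      simp only [Fin.cons_zero]
      rw [Finset.sum_congr rfl (fun i _ => hae i), Finset.sum_sub_distrib]
      simp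
      field_simp
      ring
    · rw [bt_succ, hae]; simp

theorem int_bt (g : ℕ) (c : Fin g → ℤ) :
    ∃ z : Fin (g + 1) → ℤ, ∀ j, bananaBT g (intVec c) j = z j := by
  refine ⟨Fin.cons (∑ i, c i) (fun i => - c i), fun j => ?_⟩
  refine Fin.cases ?_ (fun i => ?_) j
  · rw [bt_zero]; simp [intVec]
  · rw [bt_succ]; simp [intVec]

theorem hyp_card (n k : ℕ) :
    {x : Fin n → ℝ | (∀ j, x j = 0 ∨ x j = 1) ∧ ∑ j, x j = k}.ncard = Nat.choose n k := by
  classical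
  have h : {x : Fin n → ℝ | (∀ j, x j = 0 ∨ x j = 1) ∧ ∑ j, x j = k} =
      (fun (S : Finset (Fin n)) (j : Fin n) => if j ∈ S then (1 : ℝ) else 0) ''
        ((Finset.univ.powersetCard k : Finset (Finset (Fin n))) : Set (Finset (Fin n))) := by
    ext x
    simp only [Set.mem_setOf_eq, Set.mem_image, Finset.mem_coe, Finset.mem_powersetCard,
      Finset.subset_univ, true_and]
    constructor
    · rintro ⟨h1, h2⟩
      have hx : x = fun j => if x j = 1 then (1 : ℝ) else 0 := by
        funext j
        rcases h1 j with h | h <;> simp [h]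
      refine ⟨Finset.univ.filter fun j => x j = 1, ?_, ?_⟩
      · rw [hx] at h2
        simp only [Finset.sum_boole] at h2
        exact_mod_cast h2
      · rw [hx]; funext j; simp
    · rintro ⟨S, hS, rfl⟩
      refine ⟨fun j => ?_, ?_⟩
      · by_cases h : j ∈ S <;> simp [h]
      · simp [hS]
  rw [h, Set.ncard_image_of_injective, Set.ncard_coe_finset, Finset.card_powersetCard]
  · simp
  · intro S T hST
    ext j
    have := congrFun hST j
    by_cases h1 : j ∈ S <;> by_cases h2 : j ∈ T <;> simp_all

/-- For a Voronoi vertex `a ∈ [k]` of the banana graph: `Bᵀa` has no zero coordinate; with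
`s_a` the 0/1-vector recording the negative coordinates of `Bᵀa`, the set
`{Bᵀc + s_a : c ∈ 𝒟(a)}` is the vertex set of the hypersimplex `Δ_{k,n}`; in particular
`|𝒟(a)| = C(g+1, k)`. -/
theorem stmt7 (g k : ℕ) (hg : 1 ≤ g) (hk1 : 1 ≤ k) (hkg : k ≤ g)
    (a : Fin g → ℝ) (ha : a ∈ Set.extremePoints ℝ (voronoiPolytope (bananaQ g)))
    (hak : a ∈ bananaClass g k) :
    (∀ j, bananaBT g a j ≠ 0) ∧
    ((fun c : Fin g → ℤ =>
        bananaBT g (intVec c) + fun j => if 0 < bananaBT g a j then (0 : ℝ) else 1) ''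
        delaunaySet (bananaQ g) a =
      {x : Fin (g + 1) → ℝ | (∀ j, x j = 0 ∨ x j = 1) ∧ ∑ j, x j = k}) ∧
    (delaunaySet (bananaQ g) a).ncard = Nat.choose (g + 1) k := by
  obtain ⟨s, hs01, hsum, hs⟩ := exists_s g k hk1 a hak
  have hn : (0 : ℝ) < (g : ℝ) + 1 := by positivity
  have hp : 0 < (k : ℝ) / ((g : ℝ) + 1) := by
    have : (0 : ℝ) < k := by exact_mod_cast hk1
    positivity
  have hp1 : (k : ℝ) / ((g : ℝ) + 1) < 1 := by
    rw [div_lt_one hn]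
    have : (k : ℝ) ≤ g := by exact_mod_cast hkg
    linarith
  have hfun : (fun j => if 0 < bananaBT g a j then (0 : ℝ) else 1) = fun j => (s j : ℝ) := by
    funext j
    rw [hs j]
    rcases hs01 j with h | h
    · simp only [h, Int.cast_zero, sub_zero, hp, if_true]
    · rw [h, if_neg]
      · simp
      · push_cast; linarith
  have hsumR : ∑ j, (s j : ℝ) = k := by exact_mod_cast hsum
  -- membership in the Delaunay set
  have hmem : ∀ c : Fin g → ℤ, c ∈ delaunaySet (bananaQ g) a ↔
      ∑ j, (bananaBT g (intVec c) j + s j) * (bananaBT g (intVec c) j + s j - 1) = 0 := by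
    intro c
    have e1 : quadForm (bananaQ g) (a - intVec c) - quadForm (bananaQ g) a =
        ∑ j, (bananaBT g (intVec c) j + s j) * (bananaBT g (intVec c) j + s j - 1) := by
      have e2 : ∀ j, (bananaBT g (intVec c) j + s j) * (bananaBT g (intVec c) j + s j - 1) =
          (bananaBT g (a - intVec c) j) ^ 2 - (bananaBT g a j) ^ 2
            + (2 * ((k : ℝ) / ((g : ℝ) + 1)) - 1) * bananaBT g (intVec c) j := by
        intro j
        rw [bt_sub, hs j]
        rcases hs01 j with h | h <;> rw [h] <;> push_cast <;> ring
      rw [Finset.sum_congr rfl (fun j _ => e2 j), Finset.sum_add_distrib,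
        Finset.sum_sub_distrib, ← Finset.mul_sum, bt_sum, quad_eq, quad_eq]
      ring
    rw [← e1, sub_eq_zero]
    exact eq_comm
  rw [hfun]
  have himg : (fun c : Fin g → ℤ => bananaBT g (intVec c) + fun j => (s j : ℝ)) ''
        delaunaySet (bananaQ g) a =
      {x : Fin (g + 1) → ℝ | (∀ j, x j = 0 ∨ x j = 1) ∧ ∑ j, x j = k} := by
    ext x
    constructor
    · rintro ⟨c, hc, rfl⟩
      rw [hmem] at hc
      refine ⟨?_, ?_⟩
      · obtain ⟨z, hz⟩ := int_bt g c
        have hc' : ∑ j, (z j + s j) * (z j + s j - 1) = 0 := by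
          simp only [hz] at hc
          exact_mod_cast hc
        rw [Finset.sum_eq_zero_iff_of_nonneg] at hc'
        · intro j
          have := hc' j (Finset.mem_univ j)
          simp only [Pi.add_apply, hz]
          rcases mul_eq_zero.1 this with h | h
          · left; exact_mod_cast h
          · right
            have h' : z j + s j = 1 := by omega
            exact_mod_cast h'
        · intro j _
          rcases le_or_gt (z j + s j) 0 with h | h
          · exact mul_nonneg_of_nonpos_of_nonpos h (by omega)
          · exact mul_nonneg h.le (by omega)
      · simp only [Pi.add_apply, Finset.sum_add_distrib, bt_sum, hsumR, zero_add]
    · rintro ⟨hx01, hxs⟩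
      have hxz : ∀ j, ∃ y : ℤ, x j = y := by
        intro j
        rcases hx01 j with h | h
        · exact ⟨0, by simp [h]⟩
        · exact ⟨1, by simp [h]⟩
      choose y hy using hxz
      have key : ∀ j, bananaBT g (intVec fun i => s i.succ - y i.succ) j + s j = x j := by
        intro j
        refine Fin.cases ?_ (fun i => ?_) j
        · rw [bt_zero]
          simp only [intVec, Int.cast_sub, Finset.sum_sub_distrib, ← hy]
          rw [Fin.sum_univ_succ] at hxs hsumR
          linarith
        · rw [bt_succ]
          simp only [intVec, Int.cast_sub, ← hy]
          ring
      refine ⟨fun i => s i.succ - y i.succ, ?_, ?_⟩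
      · rw [hmem]
        refine Finset.sum_eq_zero fun j _ => ?_
        rw [key]
        rcases hx01 j with h | h <;> simp [h]
      · funext j
        exact key j
  refine ⟨?_, himg, ?_⟩
  · intro j
    rw [hs j]
    rcases hs01 j with h | h <;> rw [h] <;> push_cast
    · linarith
    · intro h; linarith
  · rw [← hyp_card, ← himg, Set.ncard_image_of_injective]
    intro c d hcd
    funext i
    have := congrFun hcd i.succ
    simp only [Pi.add_apply, bt_succ, intVec] at this
    have h2 : (c i : ℝ) = d i := by linarith
    exact_mod_cast h2
end

section
/- Let Q be a real symmetric positive definite g×g matrix, let R be a real symmetric g×g matrix, and for a ∈ ℝ^g define the (finite-support) tropical theta function θ_a(z) = Σ_{c ∈ 𝒟(a)} exp(½ cᵀRc + cᵀz) for z ∈ ℂ^g, the sum being over the finite set 𝒟(a). If a' = a − c₀ with c₀ ∈ 𝒟(a), then for every z ∈ ℂ^g one has θ_{a'}(z − Ra') = exp(−c₀ᵀz − ½ c₀ᵀRc₀ + c₀ᵀRa) · θ_a(z − Ra). In particular the two theta functions coincide up to an exponential factor. -/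
open Matrix

/-- The coordinatewise complexification of a real vector. -/
def cVec {g : ℕ} (v : Fin g → ℝ) : Fin g → ℂ := fun i => (v i : ℂ)

/-- The (finite-support) tropical theta function
`θ_a(z) = Σ_{c ∈ 𝒟(a)} exp(½ cᵀRc + cᵀz)`, the sum being over the Delaunay set `𝒟(a)`
(which is finite when `Q` is positive definite). -/
noncomputable def tropTheta {g : ℕ} (Q R : Matrix (Fin g) (Fin g) ℝ) (a : Fin g → ℝ)
    (z : Fin g → ℂ) : ℂ :=
  ∑ᶠ c ∈ delaunaySet Q a,
    Complex.exp ((((1 : ℝ) / 2 * (intVec c ⬝ᵥ R.mulVec (intVec c)) : ℝ) : ℂ) +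
      ∑ i, (c i : ℂ) * z i)

/-- If `a' = a − c₀` with `c₀ ∈ 𝒟(a)`, then for every `z ∈ ℂ^g`,
`θ_{a'}(z − Ra') = exp(−c₀ᵀz − ½ c₀ᵀRc₀ + c₀ᵀRa) · θ_a(z − Ra)`:
the two theta functions coincide up to an exponential factor. -/
theorem stmt11 {g : ℕ} (Q : Matrix (Fin g) (Fin g) ℝ) (hQs : Q.IsSymm) (hQpd : Q.PosDef)
    (R : Matrix (Fin g) (Fin g) ℝ) (hRs : R.IsSymm)
    (a a' : Fin g → ℝ) (c₀ : Fin g → ℤ) (hc₀ : c₀ ∈ delaunaySet Q a)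
    (ha' : a' = a - intVec c₀) (z : Fin g → ℂ) :
    tropTheta Q R a' (z - cVec (R.mulVec a')) =
      Complex.exp (-(∑ i, (c₀ i : ℂ) * z i) -
          (((1 : ℝ) / 2 * (intVec c₀ ⬝ᵥ R.mulVec (intVec c₀)) : ℝ) : ℂ) +
          ((intVec c₀ ⬝ᵥ R.mulVec a : ℝ) : ℂ)) *
        tropTheta Q R a (z - cVec (R.mulVec a)) := by
  have key : ∀ c : Fin g → ℤ, a' - intVec c = a - intVec (c + c₀) := by
    intro c
    rw [ha']
    ext i
    simp [intVec]
    ring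
  have hadd : ∀ c : Fin g → ℤ, intVec (c + c₀) = intVec c + intVec c₀ := by
    intro c
    ext i
    simp [intVec]
  have hmem : ∀ c : Fin g → ℤ, (c ∈ delaunaySet Q a') = (c + c₀ ∈ delaunaySet Q a) := by
    intro c
    have h0 : quadForm Q a = quadForm Q a' := by rw [ha']; exact hc₀
    simp only [delaunaySet, Set.mem_ofPred_eq, key, h0]
  have hsum : ∀ (c : Fin g → ℤ) (v : Fin g → ℝ),
      ∑ i, (c i : ℂ) * (z - cVec v) i = ∑ i, (c i : ℂ) * z i - ((intVec c ⬝ᵥ v : ℝ) : ℂ) := by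
    intro c v
    simp [dotProduct, intVec, cVec, mul_sub, Finset.sum_sub_distrib]
  have hsym : ∀ u v : Fin g → ℝ, u ⬝ᵥ R.mulVec v = v ⬝ᵥ R.mulVec u := by
    intro u v
    rw [dotProduct_mulVec, ← mulVec_transpose, hRs.eq, dotProduct_comm]
  unfold tropTheta
  rw [← smul_eq_mul, smul_finsum]
  symm
  rw [← finsum_comp_equiv (Equiv.addRight c₀)]
  refine finsum_congr fun c => ?_
  rw [smul_finsum]
  simp only [Equiv.coe_addRight]
  refine finsum_congr_Prop (hmem c).symm fun _ => ?_
  rw [smul_eq_mul, ← Complex.exp_add, hsum, hsum, hadd, ha']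
  congr 1
  have hz : ∑ i, (((c + c₀) i : ℤ) : ℂ) * z i
      = ∑ i, (c i : ℂ) * z i + ∑ i, (c₀ i : ℂ) * z i := by
    simp [add_mul, Finset.sum_add_distrib]
  rw [hz]
  simp only [mulVec_add, mulVec_sub, add_dotProduct, dotProduct_add, dotProduct_sub,
    hsym (intVec c₀) (intVec c)]
  push_cast
  ring
end

section
/- Let 𝔽 be a field, g ≥ 1, n = g+1, k ∈ {1,…,g}, let κ₁,…,κ_n ∈ 𝔽 be pairwise distinct, and let β₀ = 1 and β₁,…,β_g ∈ 𝔽 be nonzero. Define the k×n matrix A by A_{ij} = δ_{ij} for j ≤ k, and A_{ij} = β_{i−1} / (β_{j−1}(κ_j − κ_i)²) · ∏_{l ∈ I_k, l ≠ i} (κ_i − κ_l)/(κ_j − κ_l) for i ≤ k < j ≤ n, where I_k = {1,…,k}. For a k-element subset J ⊆ {1,…,n} write I_k∖J = {i₁ < … < i_s} and J∖I_k = {j₁ < … < j_s}, let A_J be the determinant of the k×k submatrix of A on the columns of J (taken in increasing order), and let K_J = ∏_{j < j′, j,j′ ∈ J}(κ_{j′} − κ_j). Then A_J = α_J · K_{I_k}/K_J,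 where α_J = [∏_{1≤l<m≤s} (κ_{i_m} − κ_{i_l})²(κ_{j_m} − κ_{j_l})² / ∏_{1≤l,m≤s} (κ_{j_m} − κ_{i_l})²] · (∏_{i ∈ I_k∖J} β_{i−1}) / (∏_{j ∈ J∖I_k} β_{j−1}), with empty products equal to 1. -/
open Finset

/-- The index set `I_k = {1,…,k}` (0-indexed: the first `k` elements of `Fin n`). -/
def IkSet (k n : ℕ) : Finset (Fin n) := Finset.univ.filter (fun j => (j : ℕ) < k)

/-- The `k × n` matrix `A` of the banana Hirota parametrization (0-indexed): `A_{ij} = δ_{ij}`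
on the first `k` columns, and
`A_{ij} = β_{i−1}/(β_{j−1}(κ_j − κ_i)²) · ∏_{l ∈ I_k, l ≠ i}(κ_i − κ_l)/(κ_j − κ_l)`
on the remaining columns. -/
noncomputable def bananaA {𝔽 : Type*} [Field 𝔽] (g k : ℕ) (hk : k ≤ g)
    (κ β : Fin (g + 1) → 𝔽) : Matrix (Fin k) (Fin (g + 1)) 𝔽 :=
  Matrix.of fun i j =>
    if (j : ℕ) < k then (if (i : ℕ) = (j : ℕ) then 1 else 0)
    else
      (β (Fin.castLE (Nat.le_succ_of_le hk) i) /
          (β j * (κ j - κ (Fin.castLE (Nat.le_succ_of_le hk) i)) ^ 2)) *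
        ∏ l ∈ (IkSet k (g + 1)).erase (Fin.castLE (Nat.le_succ_of_le hk) i),
          (κ (Fin.castLE (Nat.le_succ_of_le hk) i) - κ l) / (κ j - κ l)

/-- The maximal minor of a `k × n` matrix on the columns of a `k`-element subset `J`, taken in
increasing order. -/
noncomputable def maximalMinor {𝔽 : Type*} [Field 𝔽] {k n : ℕ} (A : Matrix (Fin k) (Fin n) 𝔽)
    (J : Finset (Fin n)) (hJ : J.card = k) : 𝔽 :=
  Matrix.det (Matrix.of fun i i' : Fin k => A i (J.orderIsoOfFin hJ i').val)

/-- The Vandermonde minor `K_J = ∏_{j < j′, j,j′ ∈ J}(κ_{j′} − κ_j)`. -/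
noncomputable def vandK {𝔽 : Type*} [Field 𝔽] {n : ℕ} (κ : Fin n → 𝔽) (J : Finset (Fin n)) :
    𝔽 :=
  ∏ p ∈ (J ×ˢ J).filter (fun p => p.1 < p.2), (κ p.2 - κ p.1)

/-- The coefficient `α_J`: writing `I_k∖J = {i₁ < … < i_s}` and `J∖I_k = {j₁ < … < j_s}`,
`α_J = [∏_{l<m}(κ_{i_m}−κ_{i_l})²(κ_{j_m}−κ_{j_l})² / ∏_{l,m}(κ_{j_m}−κ_{i_l})²]
· (∏_{i∈I_k∖J} β_{i−1})/(∏_{j∈J∖I_k} β_{j−1})` (empty products equal to `1`). -/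
noncomputable def alphaJ {𝔽 : Type*} [Field 𝔽] {n : ℕ} (k : ℕ) (κ β : Fin n → 𝔽)
    (J : Finset (Fin n)) : 𝔽 :=
  (((∏ p ∈ ((IkSet k n \ J) ×ˢ (IkSet k n \ J)).filter (fun p => p.1 < p.2),
        (κ p.2 - κ p.1) ^ 2) *
      ∏ p ∈ ((J \ IkSet k n) ×ˢ (J \ IkSet k n)).filter (fun p => p.1 < p.2),
        (κ p.2 - κ p.1) ^ 2) /
    ∏ p ∈ (IkSet k n \ J) ×ˢ (J \ IkSet k n), (κ p.2 - κ p.1) ^ 2) *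
  ((∏ i ∈ IkSet k n \ J, β i) / ∏ j ∈ J \ IkSet k n, β j)

section aux
variable {𝔽 : Type*} [Field 𝔽] {n : ℕ}

/-- product of a weight over increasing pairs -/
noncomputable def pairT (w : Fin n → Fin n → 𝔽) (S : Finset (Fin n)) : 𝔽 :=
  ∏ a ∈ S, ∏ b ∈ S, if a < b then w a b else 1

lemma pairT_eq (w : Fin n → Fin n → 𝔽) (S : Finset (Fin n)) :
    ∏ p ∈ (S ×ˢ S).filter (fun p => p.1 < p.2), w p.1 p.2 = pairT w S := by
  rw [Finset.prod_filter, Finset.prod_product]; rfl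

lemma pairT_union (w : Fin n → Fin n → 𝔽) (hw : ∀ a b, w a b = w b a)
    (S R : Finset (Fin n)) (h : Disjoint S R) :
    pairT w (S ∪ R) = pairT w S * pairT w R * ∏ a ∈ S, ∏ b ∈ R, w a b := by
  have h1 : ∏ a ∈ S, ∏ b ∈ R, w a b = (∏ a ∈ S, ∏ b ∈ R, if a < b then w a b else 1) *
      ∏ a ∈ R, ∏ b ∈ S, if a < b then w a b else 1 := by
    rw [Finset.prod_comm (s := R), ← Finset.prod_mul_distrib]
    refine Finset.prod_congr rfl fun a ha => ?_
    rw [← Finset.prod_mul_distrib]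
    refine Finset.prod_congr rfl fun b hb => ?_
    have hab : a ≠ b := fun e => Finset.disjoint_left.1 h ha (e ▸ hb)
    rcases lt_or_gt_of_ne hab with h | h
    · simp [h, h.not_gt]
    · simp [h, h.not_gt, hw a b]
  rw [h1]
  unfold pairT
  rw [Finset.prod_union h]
  simp_rw [Finset.prod_union h, Finset.prod_mul_distrib]
  ring

lemma pairT_sq (w : Fin n → Fin n → 𝔽) (hw : ∀ a b, w a b = w b a) (S : Finset (Fin n)) :
    ∏ a ∈ S, ∏ b ∈ S.erase a, w a b = pairT w S ^ 2 := by
  rw [sq]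
  conv_rhs => rhs; rw [pairT, Finset.prod_comm]
  rw [pairT, ← Finset.prod_mul_distrib]
  refine Finset.prod_congr rfl fun a ha => ?_
  rw [← Finset.prod_mul_distrib, ← Finset.mul_prod_erase _ _ ha]
  simp only [lt_irrefl, if_false, one_mul]
  refine Finset.prod_congr rfl fun b hb => ?_
  rcases lt_or_gt_of_ne (Finset.ne_of_mem_erase hb) with h | h
  · simp [h, h.not_gt, hw a b]
  · simp [h, h.not_gt]

lemma vandK_sq (κ : Fin n → 𝔽) (S : Finset (Fin n)) :
    vandK κ S ^ 2 = pairT (fun a b => (κ b - κ a) ^ 2) S := by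
  rw [vandK, ← Finset.prod_pow]
  exact pairT_eq (fun a b => (κ b - κ a) ^ 2) S

lemma vandK_ne (κ : Fin n → 𝔽) (hκ : Function.Injective κ) (S : Finset (Fin n)) :
    vandK κ S ≠ 0 := by
  rw [vandK, Finset.prod_ne_zero_iff]
  intro p hp
  rw [sub_ne_zero]
  exact fun h => (Finset.mem_filter.1 hp).2.ne' (hκ h)

lemma vandK_map {k : ℕ} (κ : Fin n → 𝔽) (e : Fin k ↪o Fin n) :
    vandK κ (Finset.univ.map e.toEmbedding) = (Matrix.vandermonde (κ ∘ e)).det := by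
  rw [Matrix.det_vandermonde, vandK]
  rw [pairT_eq (fun a b => κ b - κ a), pairT, Finset.prod_map]
  refine Finset.prod_congr rfl fun i _ => ?_
  rw [Finset.prod_map]
  simp only [RelEmbedding.coe_toEmbedding, e.lt_iff_lt]
  rw [← Finset.prod_filter]
  refine Finset.prod_congr (by ext; simp) fun j _ => rfl

lemma comb (κ : Fin n → 𝔽) (hκ : Function.Injective κ) (I J : Finset (Fin n)) :
    (∏ i ∈ I, ∏ l ∈ I.erase i, (κ l - κ i) ^ 2) / (∏ j ∈ J, ∏ l ∈ I.erase j, (κ l - κ j) ^ 2)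
      * vandK κ J ^ 2 =
    (pairT (fun a b => (κ b - κ a) ^ 2) (I \ J) * pairT (fun a b => (κ b - κ a) ^ 2) (J \ I) /
      ∏ p ∈ (I \ J) ×ˢ (J \ I), (κ p.2 - κ p.1) ^ 2) * vandK κ I ^ 2 := by
  have hw : ∀ a b, (fun a b => (κ b - κ a) ^ 2) a b = (fun a b => (κ b - κ a) ^ 2) b a := by
    intro a b; ring
  have hT : ∀ S, pairT (fun a b => (κ b - κ a) ^ 2) S ≠ 0 := fun S => by
    rw [← vandK_sq]; exact pow_ne_zero _ (vandK_ne κ hκ S)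
  have hP : ∀ S R : Finset (Fin n), Disjoint S R →
      ∏ a ∈ S, ∏ b ∈ R, (κ b - κ a) ^ 2 ≠ 0 := by
    intro S R h
    refine Finset.prod_ne_zero_iff.2 fun a ha => Finset.prod_ne_zero_iff.2 fun b hb => ?_
    refine pow_ne_zero _ (sub_ne_zero.2 fun e => ?_)
    exact Finset.disjoint_left.1 h ha (hκ e ▸ hb)
  have hBC : Disjoint (I \ J) (I ∩ J) := Finset.disjoint_left.2 (by simp; tauto)
  have hEC : Disjoint (J \ I) (I ∩ J) := Finset.disjoint_left.2 (by simp; tauto)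
  have hBE : Disjoint (I \ J) (J \ I) := Finset.disjoint_left.2 (by simp; tauto)
  have hEI : Disjoint (J \ I) I := Finset.disjoint_left.2 (by simp)
  have hI : I = (I \ J) ∪ (I ∩ J) := by ext; simp; tauto
  have hJ : J = (J \ I) ∪ (I ∩ J) := by ext; simp; tauto
  -- product over C
  have hC : ∏ i ∈ I ∩ J, ∏ l ∈ I.erase i, (κ l - κ i) ^ 2 ≠ 0 := by
    refine Finset.prod_ne_zero_iff.2 fun a ha => Finset.prod_ne_zero_iff.2 fun b hb => ?_
    refine pow_ne_zero _ (sub_ne_zero.2 fun e => ?_)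
    exact Finset.ne_of_mem_erase hb (hκ e)
  have e1 : ∏ i ∈ I, ∏ l ∈ I.erase i, (κ l - κ i) ^ 2 = 
      (∏ i ∈ I \ J, ∏ l ∈ I.erase i, (κ l - κ i) ^ 2) *
      ∏ i ∈ I ∩ J, ∏ l ∈ I.erase i, (κ l - κ i) ^ 2 := by
    rw [← Finset.prod_union hBC, ← hI]
  have e2 : ∏ i ∈ J, ∏ l ∈ I.erase i, (κ l - κ i) ^ 2 = 
      (∏ i ∈ J \ I, ∏ l ∈ I, (κ l - κ i) ^ 2) *
      ∏ i ∈ I ∩ J, ∏ l ∈ I.erase i, (κ l - κ i) ^ 2 := by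
    have : ∏ i ∈ J \ I, ∏ l ∈ I, (κ l - κ i) ^ 2 =
        ∏ i ∈ J \ I, ∏ l ∈ I.erase i, (κ l - κ i) ^ 2 := by
      refine Finset.prod_congr rfl fun a ha => ?_
      rw [Finset.erase_eq_of_notMem (Finset.mem_sdiff.1 ha).2]
    rw [this, ← Finset.prod_union hEC, ← hJ]
  have e3 : ∏ i ∈ I \ J, ∏ l ∈ I.erase i, (κ l - κ i) ^ 2 =
      pairT (fun a b => (κ b - κ a) ^ 2) (I \ J) ^ 2 *
        ∏ a ∈ I \ J, ∏ b ∈ I ∩ J, (κ b - κ a) ^ 2 := by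
    rw [← pairT_sq _ hw, ← Finset.prod_mul_distrib]
    refine Finset.prod_congr rfl fun a ha => ?_
    rw [← Finset.prod_union (hBC.mono_left (Finset.erase_subset _ _))]
    refine Finset.prod_congr ?_ fun _ _ => rfl
    ext x
    have := Finset.mem_sdiff.1 ha
    simp only [Finset.mem_erase, Finset.mem_union, Finset.mem_sdiff, Finset.mem_inter]
    constructor
    · tauto
    · rintro (h | h)
      · tauto
      · exact ⟨fun e => this.2 (e ▸ h.2), h.1⟩
  have e4 : ∏ i ∈ J \ I, ∏ l ∈ I, (κ l - κ i) ^ 2 =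
      (∏ a ∈ I \ J, ∏ b ∈ J \ I, (κ b - κ a) ^ 2) *
        ∏ a ∈ J \ I, ∏ b ∈ I ∩ J, (κ b - κ a) ^ 2 := by
    rw [Finset.prod_comm (s := I \ J), ← Finset.prod_mul_distrib]
    refine Finset.prod_congr rfl fun a ha => ?_
    rw [hI, Finset.prod_union hBC, ← hI]
    congr 1
    exact Finset.prod_congr rfl fun b _ => hw _ _
  have e5 : vandK κ I ^ 2 = pairT (fun a b => (κ b - κ a) ^ 2) (I \ J) * pairT (fun a b => (κ b - κ a) ^ 2) (I ∩ J) *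
      ∏ a ∈ I \ J, ∏ b ∈ I ∩ J, (κ b - κ a) ^ 2 := by
    rw [vandK_sq, ← pairT_union _ hw _ _ hBC, ← hI]
  have e6 : vandK κ J ^ 2 = pairT (fun a b => (κ b - κ a) ^ 2) (J \ I) * pairT (fun a b => (κ b - κ a) ^ 2) (I ∩ J) *
      ∏ a ∈ J \ I, ∏ b ∈ I ∩ J, (κ b - κ a) ^ 2 := by
    rw [vandK_sq, ← pairT_union _ hw _ _ hEC, ← hJ]
  have h6 := hT (I ∩ J)
  have h7 := hP _ _ hEC
  have h8 := hP _ _ hBE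
  rw [e1, e2, e3, e4, e5, e6, Finset.prod_product]
  simp only
  field_simp

lemma detL {k : ℕ} (κ : Fin n → 𝔽) (hκ : Function.Injective κ) (e f : Fin k ↪o Fin n) :
    (Matrix.of fun i j : Fin k =>
        ∏ l ∈ Finset.univ.erase i, (κ (f j) - κ (e l)) / (κ (e i) - κ (e l))).det =
      vandK κ (Finset.univ.map f.toEmbedding) / vandK κ (Finset.univ.map e.toEmbedding) := by
  rw [eq_div_iff (vandK_ne κ hκ _), vandK_map, vandK_map,
    ← Matrix.det_transpose (Matrix.vandermonde (κ ∘ e)),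
    ← Matrix.det_transpose (Matrix.vandermonde (κ ∘ f)), mul_comm, ← Matrix.det_mul]
  congr 1
  ext m j
  rw [Matrix.mul_apply]
  simp only [Matrix.transpose_apply, Matrix.vandermonde_apply, Matrix.of_apply, Function.comp]
  have hinj : Set.InjOn (κ ∘ e) (Finset.univ : Finset (Fin k)) :=
    (hκ.comp e.injective).injOn
  have h := Lagrange.eq_interpolate (f := (Polynomial.X : Polynomial 𝔽) ^ (m : ℕ)) hinj
    (by rw [Polynomial.degree_X_pow]; simp)
  have h2 := congrArg (Polynomial.eval (κ (f j))) h
  rw [Lagrange.interpolate_apply, Polynomial.eval_finsetSum] at h2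
  simp only [Polynomial.eval_pow, Polynomial.eval_X, Polynomial.eval_mul, Polynomial.eval_C,
    Lagrange.basis, Polynomial.eval_prod, Lagrange.basisDivisor, Polynomial.eval_sub,
    Function.comp] at h2
  rw [h2]
  refine Finset.sum_congr rfl fun i _ => ?_
  congr 1
  refine Finset.prod_congr rfl fun l _ => ?_
  rw [div_eq_mul_inv, mul_comm]

end aux

/-- For pairwise distinct `κ` and nonzero `β` with `β₀ = 1`, every maximal minor of the banana
matrix `A` satisfies `A_J = α_J · K_{I_k}/K_J`. -/
theorem stmt13 {𝔽 : Type*} [Field 𝔽] (g k : ℕ) (hg : 1 ≤ g) (hk1 : 1 ≤ k) (hkg : k ≤ g)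
    (κ β : Fin (g + 1) → 𝔽) (hκ : Function.Injective κ)
    (hβ0 : β 0 = 1) (hβ : ∀ j : Fin (g + 1), j ≠ 0 → β j ≠ 0)
    (J : Finset (Fin (g + 1))) (hJ : J.card = k) :
    maximalMinor (bananaA g k hkg κ β) J hJ =
      alphaJ k κ β J * vandK κ (IkSet k (g + 1)) / vandK κ J := by
  have hb : ∀ j, β j ≠ 0 := fun j => by
    by_cases h : j = 0
    · rw [h, hβ0]; exact one_ne_zero
    · exact hβ j h
  let e : Fin k ↪o Fin (g + 1) := Fin.castLEOrderEmb (Nat.le_succ_of_le hkg)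
  let f : Fin k ↪o Fin (g + 1) := J.orderEmbOfFin hJ
  have hI : IkSet k (g + 1) = Finset.univ.map e.toEmbedding := by
    ext x
    simp only [IkSet, Finset.mem_filter, Finset.mem_univ, true_and, Finset.mem_map]
    constructor
    · intro h; exact ⟨⟨x, h⟩, rfl⟩
    · rintro ⟨a, rfl⟩; exact a.2
  have hJf : J = Finset.univ.map f.toEmbedding := by
    rw [Finset.map_eq_image]; exact (Finset.image_orderEmbOfFin_univ J hJ).symm
  set I := IkSet k (g + 1) with hIdef
  let c : Fin (g + 1) → 𝔽 := fun j => β j * ∏ l ∈ I.erase j, (κ l - κ j) ^ 2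
  have hc : ∀ j, c j ≠ 0 := fun j => by
    refine mul_ne_zero (hb j) (Finset.prod_ne_zero_iff.2 fun b hb => ?_)
    refine pow_ne_zero _ (sub_ne_zero.2 fun e => ?_)
    exact Finset.ne_of_mem_erase hb (hκ e)
  have herase : ∀ i : Fin k, I.erase (e i) = (Finset.univ.erase i).map e.toEmbedding := by
    intro i
    rw [Finset.map_erase, ← hI]; rfl
  have key : (Matrix.of fun i i' : Fin k => bananaA g k hkg κ β i (J.orderIsoOfFin hJ i').val) =
      Matrix.diagonal (fun i => c (e i)) * (Matrix.of fun i j : Fin k =>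
        ∏ l ∈ Finset.univ.erase i, (κ (f j) - κ (e l)) / (κ (e i) - κ (e l))) *
      Matrix.diagonal (fun j => (c (f j))⁻¹) := by
    ext i j
    rw [Matrix.mul_diagonal, Matrix.diagonal_mul]
    simp only [Matrix.of_apply]
    have hfj : (J.orderIsoOfFin hJ j).val = f j := rfl
    rw [hfj]
    generalize f j = q
    have hL : ∏ l ∈ Finset.univ.erase i, (κ q - κ (e l)) / (κ (e i) - κ (e l)) =
        ∏ l ∈ I.erase (e i), (κ q - κ l) / (κ (e i) - κ l) := by
      rw [herase, Finset.prod_map]; rfl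
    rw [hL]
    have hcast : Fin.castLE (Nat.le_succ_of_le hkg) i = e i := rfl
    simp only [bananaA, Matrix.of_apply]
    rw [hcast, ← hIdef]
    have heI : e i ∈ I := by rw [hI]; exact Finset.mem_map_of_mem _ (Finset.mem_univ _)
    by_cases hq : (q : ℕ) < k
    · rw [if_pos hq]
      have hqI : q ∈ I := by simp [hIdef, IkSet, hq]
      by_cases hiq : (i : ℕ) = q
      · have : e i = q := Fin.ext hiq
        rw [if_pos hiq, this, Finset.prod_congr rfl (g := fun _ => 1), Finset.prod_const_one,
          mul_one, mul_inv_cancel₀ (hc q)]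
        intro l hl
        exact div_self (sub_ne_zero.2 fun h => Finset.ne_of_mem_erase hl (hκ h).symm)
      · rw [if_neg hiq, Finset.prod_eq_zero (i := q), mul_zero, zero_mul]
        · exact Finset.mem_erase.2 ⟨fun h => hiq (congrArg Fin.val h).symm, hqI⟩
        · simp
    · rw [if_neg hq]
      have hqI : q ∉ I := by simpa [hIdef, IkSet] using hq
      have hne : κ q - κ (e i) ≠ 0 := sub_ne_zero.2 fun h => hqI (hκ h ▸ heI)
      have hP : ∏ l ∈ I.erase (e i), (κ q - κ l) ≠ 0 :=
        Finset.prod_ne_zero_iff.2 fun l hl => sub_ne_zero.2 fun h =>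
          hqI (hκ h ▸ Finset.mem_of_mem_erase hl)
      have hD : ∏ l ∈ I.erase (e i), (κ (e i) - κ l) ≠ 0 :=
        Finset.prod_ne_zero_iff.2 fun l hl => sub_ne_zero.2 fun h =>
          Finset.ne_of_mem_erase hl (hκ h).symm
      have c1 : c (e i) = β (e i) * (∏ l ∈ I.erase (e i), (κ (e i) - κ l)) ^ 2 := by
        simp only [c]
        rw [← Finset.prod_pow]
        congr 1
        exact Finset.prod_congr rfl fun l _ => by ring
      have c2 : c q = β q * ((κ q - κ (e i)) * ∏ l ∈ I.erase (e i), (κ q - κ l)) ^ 2 := by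
        simp only [c]
        rw [Finset.erase_eq_of_notMem hqI, Finset.mul_prod_erase I (fun l => κ q - κ l) heI,
          ← Finset.prod_pow]
        congr 1
        exact Finset.prod_congr rfl fun l _ => by ring
      rw [c1, c2, Finset.prod_div_distrib, Finset.prod_div_distrib]
      have := hb q
      field_simp
  have hdet : maximalMinor (bananaA g k hkg κ β) J hJ =
      (∏ i ∈ I, c i) * (vandK κ J / vandK κ I) * (∏ j ∈ J, c j)⁻¹ := by
    have p1 : ∏ i ∈ I, c i = ∏ i : Fin k, c (e i) := by rw [hI, Finset.prod_map]; rfl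
    have p2 : ∏ i ∈ J, c i = ∏ i : Fin k, c (f i) := by
      conv_lhs => rw [hJf]
      rw [Finset.prod_map]; rfl
    have p3 := detL κ hκ e f
    rw [← hI, ← hJf] at p3
    rw [maximalMinor, key, Matrix.det_mul, Matrix.det_mul, Matrix.det_diagonal,
      Matrix.det_diagonal, p3, p1, p2, Finset.prod_inv_distrib]
  have hcomb := comb κ hκ I J
  have hbI : (∏ i ∈ I, β i) / ∏ j ∈ J, β j = (∏ i ∈ I \ J, β i) / ∏ j ∈ J \ I, β j := by
    have n1 : ∀ S : Finset (Fin (g + 1)), ∏ i ∈ S, β i ≠ 0 := fun S =>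
      Finset.prod_ne_zero_iff.2 fun i _ => hb i
    rw [← Finset.prod_inter_mul_prod_sdiff I J, ← Finset.prod_inter_mul_prod_sdiff J I,
      Finset.inter_comm J I, mul_div_mul_left _ _ (n1 _)]
  have hal : alphaJ k κ β J = (pairT (fun a b => (κ b - κ a) ^ 2) (I \ J) *
      pairT (fun a b => (κ b - κ a) ^ 2) (J \ I) /
      ∏ p ∈ (I \ J) ×ˢ (J \ I), (κ p.2 - κ p.1) ^ 2) *
      ((∏ i ∈ I, β i) / ∏ j ∈ J, β j) := by
    rw [hbI, ← pairT_eq, ← pairT_eq]; rfl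
  have nI := vandK_ne κ hκ I
  have nJ := vandK_ne κ hκ J
  rw [hdet, hal]
  simp only [c]
  rw [Finset.prod_mul_distrib, Finset.prod_mul_distrib]
  replace hcomb := (eq_div_iff (pow_ne_zero 2 nI)).2 hcomb.symm
  rw [hcomb, mul_inv]
  field_simp
end

section
/- Let R be a commutative ring, s ≥ 1, and x₁,…,x_s, y₁,…,y_s ∈ R. Let M be the s×s matrix with entries M_{r,m} = ∏_{l ≠ r} (y_m − x_l), the product over l ∈ {1,…,s}∖{r}. Then det M = (−1)^{s(s−1)/2} · ∏_{1≤l<m≤s}(x_m − x_l) · ∏_{1≤l<m≤s}(y_m − y_l). Equivalently, Σ_{π ∈ S_s} sgn(π) ∏_{r=1}^{s} ∏_{l ≠ r}(y_{π(r)} − x_l) = (−1)^{s(s−1)/2} K_X K_Y, where K_X, K_Y are the Vandermonde products of the x's and y's. -/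
open Finset

open Polynomial in
/-- coefficient matrix -/
noncomputable def cmat14 {R : Type*} [CommRing R] {s : ℕ} (x : Fin s → R) :
    Matrix (Fin s) (Fin s) R :=
  Matrix.of fun r j => (∏ l ∈ Finset.univ.erase r, (X - C (x l)) : R[X]).coeff j

open Polynomial in
lemma fact14 {R : Type*} [CommRing R] {s : ℕ} (x y : Fin s → R) :
    (Matrix.of fun r m : Fin s => ∏ l ∈ Finset.univ.erase r, (y m - x l)) =
      cmat14 x * (Matrix.vandermonde y).transpose := by
  ext r m
  have hdeg : (∏ l ∈ Finset.univ.erase r, (X - C (x l)) : R[X]).natDegree < s := by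
    have hs : 0 < s := r.pos
    refine lt_of_le_of_lt (natDegree_prod_le _ _) ?_
    refine lt_of_le_of_lt (Finset.sum_le_card_nsmul _ _ 1 fun i _ => natDegree_X_sub_C_le _) ?_
    simp [Finset.card_erase_of_mem]
    omega
  have h := eval_eq_sum_range' hdeg (y m)
  rw [eval_prod] at h
  simp only [eval_sub, eval_X, eval_C] at h
  simp only [Matrix.of_apply, Matrix.mul_apply, Matrix.transpose_apply, Matrix.vandermonde_apply,
    cmat14]
  rw [h, Finset.sum_range]

lemma diag14 {R : Type*} [CommRing R] {s : ℕ} (x : Fin s → R) :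
    ∏ r : Fin s, ∏ l ∈ Finset.univ.erase r, (x r - x l) =
      (-1 : R) ^ (s * (s - 1) / 2) * (∏ i : Fin s, ∏ j ∈ Finset.Ioi i, (x j - x i)) *
        ∏ i : Fin s, ∏ j ∈ Finset.Ioi i, (x j - x i) := by
  have h1 : ∀ r : Fin s, ∏ l ∈ Finset.univ.erase r, (x r - x l) =
      (∏ l ∈ Finset.Iio r, (x r - x l)) * ∏ l ∈ Finset.Ioi r, (x r - x l) := by
    intro r
    rw [← Finset.prod_union]
    · congr 1
      ext l
      simp
    · rw [Finset.disjoint_left]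
      intro a ha hb
      simp at ha hb
      exact lt_asymm ha hb
  have h2 : ∏ r : Fin s, ∏ l ∈ Finset.Iio r, (x r - x l) =
      ∏ i : Fin s, ∏ j ∈ Finset.Ioi i, (x j - x i) := by
    apply Finset.prod_comm'
    simp
  have h3 : ∏ r : Fin s, ∏ l ∈ Finset.Ioi r, (x r - x l) =
      (-1 : R) ^ (s * (s - 1) / 2) * ∏ i : Fin s, ∏ j ∈ Finset.Ioi i, (x j - x i) := by
    have : ∀ r l : Fin s, x r - x l = (-1) * (x l - x r) := by intros; ring
    rw [Finset.prod_congr rfl fun r _ => Finset.prod_congr rfl fun l _ => this r l]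
    simp only [Finset.prod_mul_distrib, Finset.prod_const, Fin.card_Ioi]
    rw [Finset.prod_pow_eq_pow_sum, Fin.sum_univ_eq_sum_range (fun i => s - 1 - i),
      Finset.sum_range_reflect (fun i => i), Finset.sum_range_id]
  simp only [h1, Finset.prod_mul_distrib]
  rw [h2, h3]
  ring

lemma cmap14 {R S : Type*} [CommRing R] [CommRing S] (f : R →+* S) {s : ℕ} (x : Fin s → R) :
    f (cmat14 x).det = (cmat14 (fun i => f (x i))).det := by
  rw [RingHom.map_det]
  congr 1
  ext r j
  simp [cmat14, ← Polynomial.coeff_map, Polynomial.map_prod]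

lemma gen14 {R : Type*} [CommRing R] [IsDomain R] {s : ℕ} (x : Fin s → R)
    (hx : Function.Injective x) :
    (cmat14 x).det = (-1 : R) ^ (s * (s - 1) / 2) *
      (∏ i : Fin s, ∏ j ∈ Finset.Ioi i, (x j - x i)) := by
  have h := congrArg Matrix.det (fact14 x x)
  have hd : (Matrix.of fun r m : Fin s => ∏ l ∈ Finset.univ.erase r, (x m - x l)) =
      Matrix.diagonal fun r => ∏ l ∈ Finset.univ.erase r, (x r - x l) := by
    ext r m
    by_cases hrm : r = m
    · subst hrm; simp
    · rw [Matrix.diagonal_apply_ne _ hrm, Matrix.of_apply]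
      exact Finset.prod_eq_zero (i := m) (by simp [Ne.symm hrm]) (sub_self _)
  rw [hd, Matrix.det_diagonal, diag14, Matrix.det_mul, Matrix.det_transpose,
    ← Matrix.det_vandermonde] at h
  rw [← Matrix.det_vandermonde]
  exact (mul_right_cancel₀ (Matrix.det_vandermonde_ne_zero_iff.mpr hx) h).symm

lemma cdet14 {R : Type*} [CommRing R] {s : ℕ} (x : Fin s → R) :
    (cmat14 x).det = (-1 : R) ^ (s * (s - 1) / 2) *
      (∏ i : Fin s, ∏ j ∈ Finset.Ioi i, (x j - x i)) := by
  have h := gen14 (R := MvPolynomial (Fin s) ℤ) MvPolynomial.X (MvPolynomial.X_injective)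
  have h' := congrArg (MvPolynomial.eval₂Hom (Int.castRingHom R) x) h
  rw [cmap14] at h'
  simpa using h'

lemma pairs14 {R : Type*} [CommRing R] {s : ℕ} (x : Fin s → R) :
    (∏ p ∈ (Finset.univ : Finset (Fin s × Fin s)).filter (fun p => p.1 < p.2),
      (x p.2 - x p.1)) = ∏ i : Fin s, ∏ j ∈ Finset.Ioi i, (x j - x i) := by
  apply Finset.prod_finset_product
  simp

/-- Let `M` be the `s × s` matrix with `M_{r,m} = ∏_{l ≠ r}(y_m − x_l)`. Then
`det M = (−1)^{s(s−1)/2} ∏_{l<m}(x_m − x_l) ∏_{l<m}(y_m − y_l)`; equivalently,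
`Σ_{π ∈ S_s} sgn(π) ∏_r ∏_{l≠r}(y_{π(r)} − x_l)` equals the same quantity. -/
theorem stmt14 {R : Type*} [CommRing R] (s : ℕ) (hs : 1 ≤ s) (x y : Fin s → R) :
    (Matrix.det (Matrix.of fun r m : Fin s => ∏ l ∈ Finset.univ.erase r, (y m - x l)) =
      (-1 : R) ^ (s * (s - 1) / 2) *
        (∏ p ∈ (Finset.univ : Finset (Fin s × Fin s)).filter (fun p => p.1 < p.2),
          (x p.2 - x p.1)) *
        ∏ p ∈ (Finset.univ : Finset (Fin s × Fin s)).filter (fun p => p.1 < p.2),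
          (y p.2 - y p.1)) ∧
    (∑ π : Equiv.Perm (Fin s),
        ((Equiv.Perm.sign π : ℤ) : R) *
          ∏ r : Fin s, ∏ l ∈ Finset.univ.erase r, (y (π r) - x l)) =
      (-1 : R) ^ (s * (s - 1) / 2) *
        (∏ p ∈ (Finset.univ : Finset (Fin s × Fin s)).filter (fun p => p.1 < p.2),
          (x p.2 - x p.1)) *
        ∏ p ∈ (Finset.univ : Finset (Fin s × Fin s)).filter (fun p => p.1 < p.2),
          (y p.2 - y p.1) := by
  have key : Matrix.det (Matrix.of fun r m : Fin s => ∏ l ∈ Finset.univ.erase r, (y m - x l)) =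
      (-1 : R) ^ (s * (s - 1) / 2) *
        (∏ p ∈ (Finset.univ : Finset (Fin s × Fin s)).filter (fun p => p.1 < p.2),
          (x p.2 - x p.1)) *
        ∏ p ∈ (Finset.univ : Finset (Fin s × Fin s)).filter (fun p => p.1 < p.2),
          (y p.2 - y p.1) := by
    rw [fact14, Matrix.det_mul, Matrix.det_transpose, Matrix.det_vandermonde, cdet14, pairs14,
      pairs14]
  refine ⟨key, ?_⟩
  rw [← key, ← Matrix.det_transpose, Matrix.det_apply']
  rfl
end
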